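/- Under the stated assumptions on ξ and ε, if the cycle weights are α_j = γ log j with γ > 0, then for any fixed density ρ > 0 the fraction of points in infinite cycles satisfies ν = max(0, 1 − ρ_c/ρ). -/

import Mathlib

open MeasureTheory Filter Topology ENNReal FourierTransform

noncomputable section

/-! ### Permutation combinatorics -/

/-- `r_j(π)`: the number of cycles of length `j` in `π ∈ S_N`
(fixed points count as cycles of length 1). -/
def cycCount {N : ℕ} (π : Equiv.Perm (Fin N)) (j : ℕ) : ℕ :=
  if j = 1 then N - π.cycleType.sum else Multiset.count j π.cycleType

/-- The cycle weight `exp(-∑_{j≥1} α_j r_j(π))` of a permutation `π ∈ S_N`. -/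
def permWeight (α : ℕ → ℝ) {N : ℕ} (π : Equiv.Perm (Fin N)) : ℝ :=
  Real.exp (-∑ j ∈ Finset.Icc 1 N, α j * (cycCount π j : ℝ))

/-! ### The spatial model -/

/-- Euclidean space `ℝ^d`. -/
abbrev Eu (d : ℕ) := EuclideanSpace ℝ (Fin d)

/-- The lattice point `Lz ∈ ℝ^d`, for `z ∈ ℤ^d`. -/
def latPt (d : ℕ) (L : ℝ) (z : Fin d → ℤ) : Eu d :=
  (WithLp.equiv 2 (Fin d → ℝ)).symm (fun i => L * (z i))

/-- The dual lattice point `z/L ∈ Λ* = L⁻¹ℤ^d`, for `z ∈ ℤ^d`. -/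
def dualPt (d : ℕ) (L : ℝ) (z : Fin d → ℤ) : Eu d :=
  (WithLp.equiv 2 (Fin d → ℝ)).symm (fun i => (z i) / L)

/-- The cube `Λ ⊆ ℝ^d` of side `L`. -/
def cube (d : ℕ) (L : ℝ) : Set (Eu d) := {x | ∀ i, x i ∈ Set.Ico (0:ℝ) L}

/-- The periodization `e^{-ξ_Λ(x)} = ∑_{z∈ℤ^d} e^{-ξ(x-Lz)}` (values in `[0,∞]`),
where `f = e^{-ξ}`. -/
def fper (d : ℕ) (f : Eu d → ℝ) (L : ℝ) (x : Eu d) : ℝ≥0∞ :=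
  ∑' z : Fin d → ℤ, ENNReal.ofReal (f (x - latPt d L z))

/-- The (unnormalized) Gibbs weight of a permutation `π ∈ S_N`:
`e^{-∑_j α_j r_j(π)} ∫_{Λ^N} ∏_i e^{-ξ_Λ(x_i - x_{π(i)})} dx`. -/
def gibbsW (d : ℕ) (f : Eu d → ℝ) (α : ℕ → ℝ) (L : ℝ) (N : ℕ)
    (π : Equiv.Perm (Fin N)) : ℝ≥0∞ :=
  ENNReal.ofReal (permWeight α π) *
    ∫⁻ x in Set.univ.pi (fun _ : Fin N => cube d L), ∏ i, fper d f L (x i - x (π i))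

/-- The expectation, under the Gibbs measure on `Λ^N × S_N`, of a function of the
permutation alone. -/
def gibbsE (d : ℕ) (f : Eu d → ℝ) (α : ℕ → ℝ) (L : ℝ) (N : ℕ)
    (g : Equiv.Perm (Fin N) → ℝ) : ℝ :=
  (∑ π : Equiv.Perm (Fin N), (gibbsW d f α L N π).toReal * g π) /
    (∑ π : Equiv.Perm (Fin N), (gibbsW d f α L N π).toReal)

/-- The critical density `ρ_c = ∑_{j≥1} e^{-α_j} ∫_{ℝ^d} e^{-jε(k)} dk`. -/
def rhoC (d : ℕ) (ε : Eu d → ℝ) (α : ℕ → ℝ) : ℝ :=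
  ∑' j : ℕ, Real.exp (-α (j+1)) * ∫ k : Eu d, Real.exp (-(((j:ℝ)+1) * ε k))

/-- The multiset of all cycle lengths of `π`, fixed points included. -/
def cycParts {N : ℕ} (π : Equiv.Perm (Fin N)) : Multiset ℕ :=
  π.cycleType + Multiset.replicate (N - π.cycleType.sum) 1

lemma count_cycleType_one {N : ℕ} (π : Equiv.Perm (Fin N)) : π.cycleType.count 1 = 0 :=
  Multiset.count_eq_zero.2 fun h => by
    have := Equiv.Perm.two_le_of_mem_cycleType h
    omega

lemma cycCount_eq_count {N : ℕ} (π : Equiv.Perm (Fin N)) (j : ℕ) :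
    cycCount π j = (cycParts π).count j := by
  unfold cycCount cycParts
  rw [Multiset.count_add, Multiset.count_replicate]
  split_ifs with h1 h2 h2
  · subst h1; rw [count_cycleType_one]; simp
  · exact absurd h1.symm h2
  · exact absurd h2.symm h1
  · simp

lemma sum_cycleType_le_fin {N : ℕ} (π : Equiv.Perm (Fin N)) : π.cycleType.sum ≤ N := by
  simpa using π.sum_cycleType_le

lemma sum_cycParts {N : ℕ} (π : Equiv.Perm (Fin N)) : (cycParts π).sum = N := by
  have := sum_cycleType_le_fin π
  simp [cycParts]; omega

lemma mem_cycParts {N : ℕ} {π : Equiv.Perm (Fin N)} {j : ℕ} (h : j ∈ cycParts π) :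
    j ∈ Finset.Icc 1 N := by
  have h2 : j ≤ N := (Multiset.le_sum_of_mem h).trans (sum_cycParts π).le
  unfold cycParts at h
  rw [Multiset.mem_add] at h
  rw [Finset.mem_Icc]
  refine ⟨?_, h2⟩
  rcases h with h | h
  · have := Equiv.Perm.two_le_of_mem_cycleType h; omega
  · rw [Multiset.eq_of_mem_replicate h]

lemma prod_pow_cycCount {M : Type*} [CommMonoid M] {N : ℕ} (π : Equiv.Perm (Fin N)) (S : ℕ → M) :
    ∏ j ∈ Finset.Icc 1 N, S j ^ cycCount π j = ((cycParts π).map S).prod := by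
  rw [Finset.prod_multiset_map_count]
  simp_rw [cycCount_eq_count]
  symm
  apply Finset.prod_subset
  · intro j hj
    exact mem_cycParts (Multiset.mem_toFinset.1 hj)
  · intro j _ hj
    rw [Multiset.mem_toFinset] at hj
    rw [Multiset.count_eq_zero.2 hj, pow_zero]

lemma sum_mul_cycCount {N : ℕ} (π : Equiv.Perm (Fin N)) :
    ∑ j ∈ Finset.Icc 1 N, j * cycCount π j = N := by
  conv_rhs => rw [← sum_cycParts π]
  have h := prod_pow_cycCount π (fun j => Multiplicative.ofAdd j)
  have h2 := congrArg Multiplicative.toAdd h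
  simp only [toAdd_prod, toAdd_pow, toAdd_ofAdd, smul_eq_mul] at h2
  rw [show ((cycParts π).map fun j => Multiplicative.ofAdd j).prod.toAdd = (cycParts π).sum from ?_] at h2
  · rw [← h2]; exact Finset.sum_congr rfl fun j _ => mul_comm _ _
  · induction cycParts π using Multiset.induction_on with
    | empty => simp
    | cons a s ih => simp [ih]

open Classical in
/-- The permutations with cycle counts `r`. -/
def cycFiber (N : ℕ) (r : ℕ → ℕ) : Finset (Equiv.Perm (Fin N)) :=
  Finset.univ.filter fun π => ∀ j ∈ Finset.Icc 1 N, cycCount π j = r j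

lemma mem_cycFiber {N : ℕ} {r : ℕ → ℕ} {π : Equiv.Perm (Fin N)} :
    π ∈ cycFiber N r ↔ ∀ j ∈ Finset.Icc 1 N, cycCount π j = r j := by
  simp [cycFiber]

/-- The number of permutations with prescribed cycle counts. -/
lemma card_cycCount_mul {N : ℕ} (r : ℕ → ℕ) (hr : ∑ j ∈ Finset.Icc 1 N, j * r j = N) :
    (cycFiber N r).card *
      ∏ j ∈ Finset.Icc 1 N, (j ^ r j * (r j).factorial) = N.factorial := by
  rcases Nat.eq_zero_or_pos N with rfl | hN
  · have : cycFiber 0 r = Finset.univ := by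
      refine Finset.eq_univ_of_forall fun π => mem_cycFiber.2 (by simp)
    simp [this]
  set m : Multiset ℕ := ∑ j ∈ Finset.Icc 2 N, Multiset.replicate (r j) j with hm
  have hIcc : Finset.Icc 1 N = insert 1 (Finset.Icc 2 N) := by
    ext j; simp; omega
  have hnot : 1 ∉ Finset.Icc 2 N := by simp
  have hsum : m.sum = ∑ j ∈ Finset.Icc 2 N, j * r j := by
    rw [hm, Multiset.sum_sum]
    exact Finset.sum_congr rfl fun j _ => by simp [mul_comm]
  have hsum1 : r 1 + m.sum = N := by
    rw [hsum]; rw [hIcc, Finset.sum_insert hnot] at hr; simpa using hr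
  have hcount : ∀ j, m.count j = if j ∈ Finset.Icc 2 N then r j else 0 := by
    intro j
    rw [hm, Multiset.count_sum']
    simp_rw [Multiset.count_replicate]
    rw [Finset.sum_ite_eq']
  have hmem : ∀ a ∈ m, a ∈ Finset.Icc 2 N := by
    intro a ha
    by_contra h
    have := Multiset.count_pos.2 ha
    rw [hcount, if_neg h] at this
    omega
  have hset : (cycFiber N r) =
      (Finset.univ.filter fun π : Equiv.Perm (Fin N) => π.cycleType = m) := by
    ext π
    simp only [mem_cycFiber, Finset.mem_filter, Finset.mem_univ, true_and]
    constructor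
    · intro h
      ext j
      rw [hcount]
      split_ifs with hj
      · have := h j (by rw [hIcc]; exact Finset.mem_insert_of_mem hj)
        rw [← this, cycCount, if_neg]
        rw [Finset.mem_Icc] at hj; omega
      · rw [Multiset.count_eq_zero]
        intro hmem
        apply hj
        rw [Finset.mem_Icc]
        refine ⟨Equiv.Perm.two_le_of_mem_cycleType hmem, ?_⟩
        exact (Multiset.le_sum_of_mem hmem).trans (sum_cycleType_le_fin π)
    · intro h j hj
      unfold cycCount
      split_ifs with h1
      · subst h1; rw [h]; omega
      · rw [h, hcount, if_pos]
        rw [Finset.mem_Icc] at hj ⊢; omega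
  have key := Equiv.Perm.card_of_cycleType_mul_eq (Fin N) m
  rw [if_pos, Fintype.card_fin] at key
  · rw [hset, ← key]
    congr 1
    rw [hIcc, Finset.prod_insert hnot, show N - m.sum = r 1 by omega, one_pow, one_mul, mul_assoc]
    congr 1
    rw [Finset.prod_mul_distrib]
    congr 1
    · rw [hm, Multiset.prod_sum]
      exact Finset.prod_congr rfl fun j _ => by simp
    · symm
      apply Finset.prod_subset_one_on_sdiff
      · intro a ha; exact hmem a (Multiset.mem_toFinset.1 ha)
      · intro a ha
        rw [Finset.mem_sdiff, Multiset.mem_toFinset] at ha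
        have := hcount a
        rw [if_pos ha.1, Multiset.count_eq_zero.2 ha.2] at this
        rw [← this]; rfl
      · intro a ha
        rw [hcount, if_pos (hmem a (Multiset.mem_toFinset.1 ha))]
  · refine ⟨by rw [Fintype.card_fin]; omega, fun a ha => (Finset.mem_Icc.1 (hmem a ha)).1⟩

/-- The weight of a permutation whose cycles of length `j` have weight `θ j`. -/
def cycWeight {N : ℕ} (θ : ℕ → ℝ) (π : Equiv.Perm (Fin N)) : ℝ :=
  ∏ j ∈ Finset.Icc 1 N, θ j ^ cycCount π j

lemma sum_cycWeight_fiber {N : ℕ} (θ : ℕ → ℝ) (z : ℝ) (r : ℕ → ℕ)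
    (hr : ∑ j ∈ Finset.Icc 1 N, j * r j = N) :
    z ^ N * ∑ π ∈ cycFiber N r, cycWeight θ π =
    N.factorial * ∏ j ∈ Finset.Icc 1 N, (θ j * z ^ j / j) ^ r j / (r j).factorial := by
  have h1 : ∀ π ∈ cycFiber N r, cycWeight θ π =
      ∏ j ∈ Finset.Icc 1 N, θ j ^ r j := by
    intro π hπ
    rw [mem_cycFiber] at hπ
    exact Finset.prod_congr rfl fun j hj => by rw [hπ j hj]
  rw [Finset.sum_congr rfl h1, Finset.sum_const, nsmul_eq_mul, ← card_cycCount_mul r hr]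
  have hz : z ^ N = ∏ j ∈ Finset.Icc 1 N, z ^ (j * r j) := by
    rw [Finset.prod_pow_eq_pow_sum, hr]
  rw [hz]
  push_cast
  rw [mul_left_comm, mul_assoc, ← Finset.prod_mul_distrib, ← Finset.prod_mul_distrib]
  congr 1
  refine Finset.prod_congr rfl fun j hj => ?_
  have hj0 : (j : ℝ) ≠ 0 := by
    have := (Finset.mem_Icc.1 hj).1
    positivity
  rw [div_pow, mul_pow, ← pow_mul]
  have := Nat.factorial_ne_zero (r j)
  field_simp

lemma cycWeight_nonneg {N : ℕ} {θ : ℕ → ℝ} (hθ : ∀ j, 0 ≤ θ j) (π : Equiv.Perm (Fin N)) :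
    0 ≤ cycWeight θ π :=
  Finset.prod_nonneg fun j _ => pow_nonneg (hθ j) _

/-- Lower bound on the partition function by a single vector of cycle counts. -/
lemma le_sum_cycWeight {N : ℕ} {θ : ℕ → ℝ} (hθ : ∀ j, 0 ≤ θ j) {z : ℝ} (hz : 0 ≤ z) (r : ℕ → ℕ)
    (hr : ∑ j ∈ Finset.Icc 1 N, j * r j = N) :
    N.factorial * ∏ j ∈ Finset.Icc 1 N, (θ j * z ^ j / j) ^ r j / (r j).factorial ≤
      z ^ N * ∑ π : Equiv.Perm (Fin N), cycWeight θ π := by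
  rw [← sum_cycWeight_fiber θ z r hr]
  refine mul_le_mul_of_nonneg_left ?_ (pow_nonneg hz N)
  exact Finset.sum_le_sum_of_subset_of_nonneg (Finset.subset_univ _)
    fun π _ _ => cycWeight_nonneg hθ π

lemma prod_Icc_one_eq_fin {M : Type*} [CommMonoid M] (N : ℕ) (F : ℕ → M) :
    ∏ j ∈ Finset.Icc 1 N, F j = ∏ i : Fin N, F (i + 1) := by
  rw [Fin.prod_univ_eq_prod_range (fun i => F (i + 1)) N, Finset.range_eq_Ico,
    Finset.prod_Ico_add' F 0 N 1]
  rfl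

/-- Upper bound on the partition function by the grand-canonical one. -/
lemma sum_cycWeight_le {N : ℕ} {θ : ℕ → ℝ} (hθ : ∀ j, 0 ≤ θ j) {z : ℝ} (hz : 0 ≤ z) :
    z ^ N * ∑ π : Equiv.Perm (Fin N), cycWeight θ π ≤
      N.factorial * Real.exp (∑ j ∈ Finset.Icc 1 N, θ j * z ^ j / j) := by
  classical
  set y : ℕ → ℝ := fun j => θ j * z ^ j / j with hy
  have hy0 : ∀ j, 0 ≤ y j := fun j => by have := hθ j; positivity
  have hc : ∀ π : Equiv.Perm (Fin N), ∀ j ∈ Finset.Icc 1 N, cycCount π j ≤ N := by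
    intro π j hj
    have h := Finset.single_le_sum (f := fun j => j * cycCount π j) (fun _ _ => Nat.zero_le _) hj
    rw [sum_mul_cycCount] at h
    have := (Finset.mem_Icc.1 hj).1
    nlinarith [Nat.zero_le (cycCount π j)]
  have hmaps : ∀ π ∈ (Finset.univ : Finset (Equiv.Perm (Fin N))),
      (fun i : Fin N => cycCount π (i + 1)) ∈
        Fintype.piFinset (fun _ : Fin N => Finset.range (N + 1)) := by
    intro π _
    rw [Fintype.mem_piFinset]
    intro i
    rw [Finset.mem_range]
    have := hc π (i + 1) (by rw [Finset.mem_Icc]; omega)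
    omega
  rw [← Finset.sum_fiberwise_of_maps_to hmaps, Finset.mul_sum, Real.exp_sum]
  have hbound : ∏ j ∈ Finset.Icc 1 N, Real.exp (y j) ≥
      ∑ p ∈ Fintype.piFinset (fun _ : Fin N => Finset.range (N + 1)),
        ∏ i : Fin N, y (i + 1) ^ p i / (p i).factorial := by
    rw [prod_Icc_one_eq_fin,
      ← Finset.prod_univ_sum (fun _ : Fin N => Finset.range (N + 1))
        (fun i n => y (i + 1) ^ n / (n.factorial : ℝ))]
    refine Finset.prod_le_prod (fun i _ => Finset.sum_nonneg fun n _ => ?_) fun i _ => ?_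
    · have := hy0 (i + 1); positivity
    · exact Real.sum_le_exp_of_nonneg (hy0 _) _
  refine le_trans ?_ (mul_le_mul_of_nonneg_left hbound (Nat.cast_nonneg _))
  rw [Finset.mul_sum]
  refine Finset.sum_le_sum fun p _ => ?_
  set r : ℕ → ℕ := fun j => if h : j - 1 < N then p ⟨j - 1, h⟩ else 0 with hr
  have hrp : ∀ i : Fin N, r (i + 1) = p i := by
    intro i; simp [hr]
  have hfil : (Finset.univ.filter fun π : Equiv.Perm (Fin N) =>
      (fun i : Fin N => cycCount π (i + 1)) = p) =
      (cycFiber N r) := by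
    ext π
    simp only [mem_cycFiber, Finset.mem_filter, Finset.mem_univ, true_and]
    constructor
    · rintro rfl j hj
      rw [Finset.mem_Icc] at hj
      have : j - 1 < N := by omega
      simp only [hr, this, dif_pos]
      congr 1; omega
    · intro h
      funext i
      rw [h _ (by rw [Finset.mem_Icc]; omega), hrp]
  rw [hfil]
  have hR : ∏ i : Fin N, y (i + 1) ^ p i / ((p i).factorial : ℝ) =
      ∏ j ∈ Finset.Icc 1 N, y j ^ r j / ((r j).factorial : ℝ) := by
    rw [prod_Icc_one_eq_fin]
    exact Finset.prod_congr rfl fun i _ => by rw [hrp]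
  rw [hR]
  by_cases hsum : ∑ j ∈ Finset.Icc 1 N, j * r j = N
  · exact (sum_cycWeight_fiber θ z r hsum).le
  · have hempty : cycFiber N r = ∅ := by
      refine Finset.eq_empty_of_forall_notMem fun π h => hsum ?_
      refine Eq.trans ?_ (sum_mul_cycCount π)
      exact Finset.sum_congr rfl fun j hj => by rw [mem_cycFiber.1 h j hj]
    rw [hempty, Finset.sum_empty, mul_zero]
    refine mul_nonneg (Nat.cast_nonneg _) (Finset.prod_nonneg fun j _ => ?_)
    have := hy0 j
    positivity

lemma cycWeight_pos {N : ℕ} {θ : ℕ → ℝ} (hθ : ∀ j, 0 < θ j) (π : Equiv.Perm (Fin N)) :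
    0 < cycWeight θ π :=
  Finset.prod_pos fun j _ => pow_pos (hθ j) _

lemma sum_cycWeight_pos {N : ℕ} {θ : ℕ → ℝ} (hθ : ∀ j, 0 < θ j) :
    0 < ∑ π : Equiv.Perm (Fin N), cycWeight θ π :=
  Finset.sum_pos (fun π _ => cycWeight_pos hθ π) Finset.univ_nonempty

/-- The expected number of cycles of length `j` under the weights `θ`. -/
def meanCount (θ : ℕ → ℝ) (N j : ℕ) : ℝ :=
  (∑ π : Equiv.Perm (Fin N), cycWeight θ π * cycCount π j) /
    ∑ π : Equiv.Perm (Fin N), cycWeight θ π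

/-- The difference between the grand-canonical and the canonical log-partition functions. -/
def entropyGap (θ : ℕ → ℝ) (z : ℝ) (N : ℕ) : ℝ :=
  ∑ i ∈ Finset.Icc 1 N, θ i * z ^ i / i -
    Real.log (z ^ N * (∑ π : Equiv.Perm (Fin N), cycWeight θ π) / N.factorial)

lemma cycWeight_update {N : ℕ} (θ : ℕ → ℝ) (t : ℝ) {j : ℕ} (hj : j ∈ Finset.Icc 1 N)
    (π : Equiv.Perm (Fin N)) :
    cycWeight (Function.update θ j (Real.exp t * θ j)) π =
      cycWeight θ π * Real.exp (t * cycCount π j) := by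
  unfold cycWeight
  rw [← Finset.mul_prod_erase _ _ hj, ← Finset.mul_prod_erase _ (fun i => θ i ^ cycCount π i) hj,
    Function.update_self, mul_pow, ← Real.exp_nat_mul, mul_comm (t : ℝ)]
  rw [Finset.prod_congr rfl (g := fun i => θ i ^ cycCount π i)]
  · ring
  · intro i hi
    rw [Function.update_of_ne (Finset.ne_of_mem_erase hi)]

/-- Jensen's inequality and the grand-canonical bound control exponential tilts of the
mean cycle counts. -/
lemma mul_meanCount_le {N : ℕ} {θ : ℕ → ℝ} (hθ : ∀ j, 0 < θ j) {z : ℝ} (hz : 0 < z) (t : ℝ)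
    {j : ℕ} (hj : j ∈ Finset.Icc 1 N) :
    t * meanCount θ N j ≤ (Real.exp t - 1) * (θ j * z ^ j / j) + entropyGap θ z N := by
  set Z := ∑ π : Equiv.Perm (Fin N), cycWeight θ π with hZ
  have hZpos : 0 < Z := sum_cycWeight_pos hθ
  set θ' := Function.update θ j (Real.exp t * θ j) with hθ'
  have hθ'0 : ∀ i, 0 ≤ θ' i := by
    intro i
    rcases eq_or_ne i j with rfl | h
    · rw [hθ', Function.update_self]; have := hθ i; positivity
    · rw [hθ', Function.update_of_ne h]; exact (hθ i).le
  have hjen : Real.exp (t * meanCount θ N j) * Z ≤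
      ∑ π : Equiv.Perm (Fin N), cycWeight θ π * Real.exp (t * cycCount π j) := by
    have h := convexOn_exp.map_sum_le (t := (Finset.univ : Finset (Equiv.Perm (Fin N))))
      (w := fun π => cycWeight θ π / Z) (p := fun π => t * cycCount π j)
      (fun π _ => div_nonneg (cycWeight_pos hθ π).le hZpos.le)
      (by rw [← Finset.sum_div, div_self hZpos.ne']) (fun _ _ => Set.mem_univ _)
    simp only [smul_eq_mul] at h
    rw [← le_div_iff₀ hZpos, Finset.sum_div]
    refine le_trans (le_of_eq ?_) (h.trans (le_of_eq ?_))
    · rw [meanCount, Finset.sum_div, Finset.mul_sum]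
      congr 1
      exact Finset.sum_congr rfl fun π _ => by ring
    · exact Finset.sum_congr rfl fun π _ => by ring
  have hup := sum_cycWeight_le (N := N) hθ'0 hz.le
  have hsum : ∑ i ∈ Finset.Icc 1 N, θ' i * z ^ i / i =
      ∑ i ∈ Finset.Icc 1 N, θ i * z ^ i / i + (Real.exp t - 1) * (θ j * z ^ j / j) := by
    rw [← Finset.add_sum_erase _ _ hj, ← Finset.add_sum_erase _ (fun i => θ i * z ^ i / i) hj,
      hθ', Function.update_self,
      Finset.sum_congr rfl (g := fun i => θ i * z ^ i / i)]
    · ring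
    · intro i hi
      rw [Function.update_of_ne (Finset.ne_of_mem_erase hi)]
  rw [hsum, Finset.sum_congr rfl fun π _ => cycWeight_update θ t hj π] at hup
  have hN : (0 : ℝ) < N.factorial := by positivity
  have hzN : 0 < z ^ N := pow_pos hz N
  have h1 : Real.exp (t * meanCount θ N j) * (z ^ N * Z / N.factorial) ≤
      Real.exp (∑ i ∈ Finset.Icc 1 N, θ i * z ^ i / i +
        (Real.exp t - 1) * (θ j * z ^ j / j)) := by
    rw [← mul_div_assoc, div_le_iff₀ hN]
    calc _ = z ^ N * (Real.exp (t * meanCount θ N j) * Z) := by ring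
      _ ≤ _ := mul_le_mul_of_nonneg_left hjen hzN.le
      _ ≤ _ := hup.trans (le_of_eq (mul_comm _ _))
  have hq : 0 < z ^ N * Z / N.factorial := by positivity
  have h2 := Real.log_le_log (by positivity) h1
  rw [Real.log_mul (Real.exp_pos _).ne' hq.ne', Real.log_exp, Real.log_exp] at h2
  unfold entropyGap
  rw [← hZ]
  linarith

lemma factorial_le_mul_exp (r : ℕ) (hr : 1 ≤ r) :
    (r.factorial : ℝ) ≤ r * r ^ r * Real.exp (1 - r) := by
  induction r, hr using Nat.le_induction with
  | base => simp
  | succ r hr ih =>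
    have hr0 : (0 : ℝ) < r := by positivity
    have key : (r : ℝ) ^ (r + 1) * Real.exp 1 ≤ (r + 1) ^ (r + 1) := by
      have h1 : Real.exp 1 ≤ ((r + 1) / r : ℝ) ^ (r + 1) := by
        rw [← Real.le_log_iff_exp_le (by positivity), Real.log_pow]
        have h := Real.one_sub_inv_le_log_of_pos (x := ((r + 1) / r : ℝ)) (by positivity)
        have h2 : 1 - ((r + 1) / r : ℝ)⁻¹ = 1 / (r + 1) := by field_simp; ring
        rw [h2] at h
        have h3 : ((r + 1 : ℕ) : ℝ) * (1 / (r + 1)) = 1 := by push_cast; field_simp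
        nlinarith [mul_le_mul_of_nonneg_left h (Nat.cast_nonneg (α := ℝ) (r + 1))]
      calc (r : ℝ) ^ (r + 1) * Real.exp 1 ≤ r ^ (r + 1) * ((r + 1) / r : ℝ) ^ (r + 1) :=
            mul_le_mul_of_nonneg_left h1 (by positivity)
        _ = (r + 1) ^ (r + 1) := by rw [← mul_pow]; congr 1; field_simp
    have he : Real.exp (1 - r) = Real.exp 1 * Real.exp (1 - (r + 1 : ℕ)) := by
      rw [← Real.exp_add]; congr 1; push_cast; ring
    rw [Nat.factorial_succ]
    push_cast
    calc ((r : ℝ) + 1) * r.factorial ≤ (r + 1) * (r * r ^ r * Real.exp (1 - r)) :=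
          mul_le_mul_of_nonneg_left ih (by positivity)
      _ = (r + 1) * (r ^ (r + 1) * Real.exp 1) * Real.exp (1 - (r + 1 : ℕ)) := by
          rw [he]; ring
      _ ≤ (r + 1) * (r + 1) ^ (r + 1) * Real.exp (1 - (r + 1 : ℕ)) := by gcongr
      _ = _ := by push_cast; ring

/-- The largest Poisson weight is at least `exp(-2) / (y + 1)`. -/
lemma log_pow_floor_div_factorial {y : ℝ} (hy : 0 < y) :
    y - 2 - Real.log (y + 1) ≤ Real.log (y ^ ⌊y⌋₊ / (⌊y⌋₊).factorial) := by
  rcases Nat.eq_zero_or_pos ⌊y⌋₊ with h | h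
  · rw [h]
    have h1 : y < 1 := by simpa using (Nat.floor_eq_zero.1 h)
    have h2 : 0 ≤ Real.log (y + 1) := Real.log_nonneg (by linarith)
    simp; linarith
  · set r := ⌊y⌋₊ with hr
    have hr0 : (0 : ℝ) < r := by positivity
    have hry : (r : ℝ) ≤ y := Nat.floor_le hy.le
    have hyr : y < r + 1 := Nat.lt_floor_add_one y
    have hf : (0 : ℝ) < r.factorial := by positivity
    have h1 : Real.exp (r - 1) / r ≤ y ^ r / r.factorial := by
      rw [div_le_div_iff₀ hr0 hf]
      have h2 := factorial_le_mul_exp r h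
      calc Real.exp (r - 1) * r.factorial
          ≤ Real.exp (r - 1) * (r * r ^ r * Real.exp (1 - r)) := by gcongr
        _ = r ^ r * r * (Real.exp (r - 1) * Real.exp (1 - r)) := by ring
        _ = r ^ r * r := by rw [← Real.exp_add]; simp
        _ ≤ y ^ r * r := by gcongr
    have h3 := Real.log_le_log (by positivity) h1
    rw [Real.log_div (Real.exp_pos _).ne' hr0.ne', Real.log_exp] at h3
    have h4 : Real.log r ≤ Real.log (y + 1) := Real.log_le_log hr0 (by linarith)
    linarith

/-- Bound on the entropy gap: fill cycles of length at most `J` up to their grand-canonical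
occupations, and put all remaining points in a single cycle of length `n`. -/
lemma entropyGap_le {N J n : ℕ} {θ : ℕ → ℝ} (hθ : ∀ j, 0 < θ j) {z : ℝ} (hz : 0 < z) (hJn : J < n)
    (hn : n + ∑ i ∈ Finset.Icc 1 J, i * ⌊θ i * z ^ i / i⌋₊ = N) :
    entropyGap θ z N ≤ ∑ i ∈ Finset.Icc (J + 1) N, θ i * z ^ i / i +
      ∑ i ∈ Finset.Icc 1 J, (2 + Real.log (θ i * z ^ i / i + 1)) -
      Real.log (θ n * z ^ n / n) := by
  set y : ℕ → ℝ := fun i => θ i * z ^ i / i with hy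
  have hy0 : ∀ i, 1 ≤ i → 0 < y i := by
    intro i hi
    have := hθ i
    have hi' : (0 : ℝ) < i := by exact_mod_cast hi
    positivity
  set r : ℕ → ℕ := fun i => if i ≤ J then ⌊y i⌋₊ else if i = n then 1 else 0 with hr
  change n + ∑ i ∈ Finset.Icc 1 J, i * ⌊y i⌋₊ = N at hn
  have hnN : n ≤ N := by omega
  have hsplit : Finset.Icc 1 N = Finset.Icc 1 J ∪ Finset.Icc (J + 1) N := by
    ext i; simp; omega
  have hdisj : Disjoint (Finset.Icc 1 J) (Finset.Icc (J + 1) N) := by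
    rw [Finset.disjoint_left]; intro i; simp; omega
  have hnmem : n ∈ Finset.Icc (J + 1) N := by simp; omega
  have hr1 : ∀ i ∈ Finset.Icc 1 J, r i = ⌊y i⌋₊ := by
    intro i hi; rw [Finset.mem_Icc] at hi; simp [hr, hi.2]
  have hr2 : ∀ i ∈ Finset.Icc (J + 1) N, r i = if i = n then 1 else 0 := by
    intro i hi; rw [Finset.mem_Icc] at hi
    have : ¬ i ≤ J := by omega
    simp [hr, this]
  have hrsum : ∑ i ∈ Finset.Icc 1 N, i * r i = N := by
    rw [hsplit, Finset.sum_union hdisj, Finset.sum_congr rfl fun i hi => by rw [hr1 i hi],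
      Finset.sum_congr (s₁ := Finset.Icc (J + 1) N) rfl fun i hi => by rw [hr2 i hi]]
    simp only [mul_ite, mul_one, mul_zero]
    rw [Finset.sum_ite_eq' , if_pos hnmem]
    omega
  have hlow := le_sum_cycWeight (fun j => (hθ j).le) hz.le r hrsum
  have hprod : ∏ i ∈ Finset.Icc 1 N, y i ^ r i / (r i).factorial =
      (∏ i ∈ Finset.Icc 1 J, y i ^ ⌊y i⌋₊ / (⌊y i⌋₊).factorial) * y n := by
    rw [hsplit, Finset.prod_union hdisj, Finset.prod_congr rfl fun i hi => by rw [hr1 i hi],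
      Finset.prod_congr (s₁ := Finset.Icc (J + 1) N) rfl fun i hi => by rw [hr2 i hi]]
    congr 1
    rw [Finset.prod_eq_single n]
    · simp
    · intro i _ hi; simp [hi]
    · intro h; exact absurd hnmem h
  rw [hprod] at hlow
  have hN : (0 : ℝ) < N.factorial := by positivity
  have hfac : ∀ i ∈ Finset.Icc 1 J, 0 < y i ^ ⌊y i⌋₊ / (⌊y i⌋₊).factorial := by
    intro i hi
    have := hy0 i (Finset.mem_Icc.1 hi).1
    positivity
  have hn1 : 0 < y n := hy0 n (by omega)
  have h1 : (∏ i ∈ Finset.Icc 1 J, y i ^ ⌊y i⌋₊ / (⌊y i⌋₊).factorial) * y n ≤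
      z ^ N * (∑ π : Equiv.Perm (Fin N), cycWeight θ π) / N.factorial := by
    rw [le_div_iff₀ hN]; linarith
  have h2 := Real.log_le_log (mul_pos (Finset.prod_pos hfac) hn1) h1
  rw [Real.log_mul (Finset.prod_pos hfac).ne' hn1.ne',
    Real.log_prod fun i hi => (hfac i hi).ne'] at h2
  have h3 : ∑ i ∈ Finset.Icc 1 J, (y i - 2 - Real.log (y i + 1)) ≤
      ∑ i ∈ Finset.Icc 1 J, Real.log (y i ^ ⌊y i⌋₊ / (⌊y i⌋₊).factorial) :=
    Finset.sum_le_sum fun i hi => log_pow_floor_div_factorial (hy0 i (Finset.mem_Icc.1 hi).1)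
  have h4 : ∑ i ∈ Finset.Icc 1 N, y i =
      ∑ i ∈ Finset.Icc 1 J, y i + ∑ i ∈ Finset.Icc (J + 1) N, y i := by
    rw [hsplit, Finset.sum_union hdisj]
  have h5 : ∑ i ∈ Finset.Icc 1 J, (y i - 2 - Real.log (y i + 1)) =
      ∑ i ∈ Finset.Icc 1 J, y i - ∑ i ∈ Finset.Icc 1 J, (2 + Real.log (y i + 1)) := by
    rw [← Finset.sum_sub_distrib]
    exact Finset.sum_congr rfl fun i _ => by ring
  unfold entropyGap
  change ∑ i ∈ Finset.Icc 1 N, y i - _ ≤ ∑ i ∈ Finset.Icc (J + 1) N, y i +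
    ∑ i ∈ Finset.Icc 1 J, (2 + Real.log (y i + 1)) - Real.log (y n)
  linarith

lemma eventually_log_mul_le {V : ℕ → ℝ} (hV : Tendsto V atTop atTop) {C δ : ℝ} (hC : 0 < C)
    (hδ : 0 < δ) : ∀ᶠ m in atTop, Real.log (C * V m) ≤ δ * V m := by
  have h1 : Tendsto (fun m => C * V m) atTop atTop := hV.const_mul_atTop hC
  have h2 := (Real.isLittleO_log_id_atTop.comp_tendsto h1).bound (div_pos hδ hC)
  filter_upwards [h2, hV.eventually_gt_atTop 0] with m hm hVm
  simp only [Function.comp, id, Real.norm_eq_abs] at hm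
  rw [abs_of_pos (mul_pos hC hVm)] at hm
  calc _ ≤ _ := le_abs_self _
    _ ≤ _ := hm
    _ = δ * V m := by field_simp

/-- At fixed density the canonical and the grand-canonical log-partition functions agree to
leading order in the volume, at fugacity `z = 1` or at the fugacity matching the density. -/
lemma entropyGap_le_mul {γ ρ : ℝ} (hγ : 0 < γ) (hρ : 0 < ρ) {V : ℕ → ℝ} {N : ℕ → ℕ}
    (hV : Tendsto V atTop atTop) (hN : ∀ m, (N m : ℝ) = ρ * V m)
    {θ : ℕ → ℕ → ℝ} {c : ℕ → ℝ} (hc : ∀ j, 1 ≤ j → 0 < c j)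
    (hθc : ∀ j, 1 ≤ j → Tendsto (fun m => θ m j / V m) atTop (𝓝 (c j)))
    (hθpos : ∀ᶠ m in atTop, ∀ j, 0 < θ m j)
    (hθlow : ∀ᶠ m in atTop, ∀ j : ℕ, 1 ≤ j → (j : ℝ) ^ (-γ) ≤ θ m j)
    (hθup : ∀ᶠ m in atTop, ∀ j : ℕ, 1 ≤ j → θ m j ≤ (j : ℝ) ^ (-γ) * θ m 1)
    {z R : ℝ} (hz : 0 < z) (hz1 : z ≤ 1) (hR : HasSum (fun j : ℕ => c (j + 1) * z ^ (j + 1)) R)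
    (hRρ : R ≤ ρ) (hzR : z = 1 ∨ R = ρ) {δ : ℝ} (hδ : 0 < δ) :
    ∀ᶠ m in atTop, entropyGap (θ m) z (N m) ≤ δ * V m := by
  have hc1 := hc 1 le_rfl
  set A : ℕ → ℝ := fun J => ∑ i ∈ Finset.Icc 1 J, c i * z ^ i with hA
  have hAr : ∀ J, A J = ∑ i ∈ Finset.range J, c (i + 1) * z ^ (i + 1) := by
    intro J
    rw [hA, Finset.range_eq_Ico, Finset.sum_Ico_add' (fun i => c i * z ^ i) 0 J 1]
    rfl
  have hterm : ∀ i : ℕ, 0 < c (i + 1) * z ^ (i + 1) := fun i =>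
    mul_pos (hc _ (by omega)) (pow_pos hz _)
  have hAlim : Tendsto A atTop (𝓝 R) := by
    have := hR.tendsto_sum_nat
    simpa only [← hAr] using this
  have hAlt : ∀ J, A J < ρ := by
    intro J
    refine lt_of_lt_of_le ?_ hRρ
    calc A J < A (J + 1) := by
          rw [hAr, hAr, Finset.sum_range_succ]; linarith [hterm J]
      _ ≤ R := by
          rw [hAr]; exact sum_le_hasSum _ (fun i _ => (hterm i).le) hR
  set l := Real.log (1 / z) with hl
  have hl0 : 0 ≤ l := Real.log_nonneg (by rw [le_div_iff₀ hz]; linarith)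
  have hlA : Tendsto (fun J => l * (ρ - A J)) atTop (𝓝 0) := by
    have : l * (ρ - R) = 0 := by
      rcases hzR with h | h
      · rw [hl, h]; simp
      · rw [h]; simp
    rw [← this]
    exact (tendsto_const_nhds.sub hAlim).const_mul l
  have hb : Summable (fun i : ℕ => (i : ℝ) ^ (-γ - 1)) := by
    rw [Real.summable_nat_rpow]; linarith
  obtain ⟨s, hs⟩ := summable_iff_vanishing_norm.1 hb (δ / (4 * (c 1 + 1))) (by positivity)
  obtain ⟨J, hJs, hJl⟩ : ∃ J, (∀ i ∈ s, i ≤ J) ∧ l * (ρ - A J) < δ / 8 := by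
    have h1 := hlA.eventually_lt_const (show (0 : ℝ) < δ / 8 by positivity)
    have h2 := eventually_ge_atTop (s.sup id)
    obtain ⟨J, h3, h4⟩ := (h1.and h2).exists
    exact ⟨J, fun i hi => (Finset.le_sup (f := id) hi).trans h4, h3⟩
  set T : ℕ → ℝ := fun m => ∑ i ∈ Finset.Icc 1 J, θ m i * z ^ i with hT
  have hTlim : Tendsto (fun m => T m / V m) atTop (𝓝 (A J)) := by
    have : Tendsto (fun m => ∑ i ∈ Finset.Icc 1 J, θ m i / V m * z ^ i) atTop (𝓝 (A J)) :=
      tendsto_finsetSum _ fun i hi => (hθc i (Finset.mem_Icc.1 hi).1).mul_const _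
    refine this.congr fun m => ?_
    rw [hT, Finset.sum_div]
    exact Finset.sum_congr rfl fun i _ => by ring
  set B : ℝ := ∑ i ∈ Finset.Icc 1 J, (i : ℝ) with hB
  have hVinv : Tendsto (fun m => B / V m) atTop (𝓝 0) := hV.const_div_atTop B
  have hcost : ∀ᶠ m in atTop, l * (ρ - T m / V m + B / V m) < δ / 8 := by
    have h : Tendsto (fun m => l * (ρ - T m / V m + B / V m)) atTop (𝓝 (l * (ρ - A J + 0))) :=
      ((tendsto_const_nhds.sub hTlim).add hVinv).const_mul l
    rw [add_zero] at h
    exact h.eventually_lt_const hJl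
  have hTlt : ∀ᶠ m in atTop, T m / V m < (ρ + A J) / 2 :=
    hTlim.eventually_lt_const (by linarith [hAlt J])
  have hVbig : ∀ᶠ m in atTop, (J : ℝ) < (ρ - A J) / 2 * V m :=
    (hV.const_mul_atTop (show 0 < (ρ - A J) / 2 by linarith [hAlt J])).eventually_gt_atTop _
  have hθ1 : ∀ᶠ m in atTop, θ m 1 / V m < c 1 + 1 :=
    (hθc 1 le_rfl).eventually_lt_const (by linarith)
  have hlogN : ∀ᶠ m in atTop, Real.log (ρ * V m) ≤ δ / (8 * (γ + 1)) * V m :=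
    eventually_log_mul_le hV hρ (by positivity)
  have hlogs : ∀ᶠ m in atTop, ∀ i ∈ Finset.Icc 1 J,
      2 + Real.log (θ m i * z ^ i / i + 1) ≤ δ / (4 * (J + 1)) * V m := by
    rw [Filter.eventually_all_finset]
    intro i hi
    have hi1 := (Finset.mem_Icc.1 hi).1
    have hi1' : (1 : ℝ) ≤ i := by exact_mod_cast hi1
    have hci := hc i hi1
    have h1 : ∀ᶠ m in atTop, θ m i / V m < c i + 1 :=
      (hθc i hi1).eventually_lt_const (by linarith)
    have h2 := eventually_log_mul_le hV (C := c i + 2) (δ := δ / (8 * (J + 1))) (by linarith)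
      (by positivity)
    have h3 : ∀ᶠ m in atTop, 2 ≤ δ / (8 * (J + 1)) * V m :=
      (hV.const_mul_atTop (by positivity)).eventually_ge_atTop _
    filter_upwards [h1, h2, h3, hV.eventually_ge_atTop 1, hθpos] with m h1 h2 h3 hV1 hpos
    have hV0 : 0 < V m := by linarith
    rw [div_lt_iff₀ hV0] at h1
    have h4 : θ m i * z ^ i / i ≤ θ m i := by
      rw [div_le_iff₀ (by linarith)]
      have := hpos i
      exact mul_le_mul_of_nonneg_left ((pow_le_one₀ hz.le hz1).trans hi1') this.le
    have h5 : Real.log (θ m i * z ^ i / i + 1) ≤ Real.log ((c i + 2) * V m) := by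
      refine Real.log_le_log ?_ (by nlinarith)
      have := hpos i
      positivity
    have h6 : δ / (4 * (J + 1)) = δ / (8 * (J + 1)) + δ / (8 * ((J : ℝ) + 1)) := by
      field_simp; ring
    rw [h6]; linarith
  filter_upwards [hcost, hTlt, hVbig, hθ1, hlogN, hlogs, hV.eventually_ge_atTop 1, hθpos, hθlow,
    hθup] with m hcost hTlt hVbig hθ1 hlogN hlogs hV1 hpos hlow hup
  have hV0 : 0 < V m := by linarith
  set y : ℕ → ℝ := fun i => θ m i * z ^ i / i with hy
  have hfloor_le : ∑ i ∈ Finset.Icc 1 J, (i : ℝ) * ⌊y i⌋₊ ≤ T m := by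
    refine Finset.sum_le_sum fun i hi => ?_
    have hi1 : (0 : ℝ) < i := by exact_mod_cast (Finset.mem_Icc.1 hi).1
    have h0 : 0 ≤ y i := by have := hpos i; positivity
    have := Nat.floor_le h0
    calc (i : ℝ) * ⌊y i⌋₊ ≤ i * y i := by gcongr
      _ = _ := by rw [hy]; field_simp
  have hfloor_ge : T m - B ≤ ∑ i ∈ Finset.Icc 1 J, (i : ℝ) * ⌊y i⌋₊ := by
    rw [hT, hB, ← Finset.sum_sub_distrib]
    refine Finset.sum_le_sum fun i hi => ?_
    have hi1 : (0 : ℝ) < i := by exact_mod_cast (Finset.mem_Icc.1 hi).1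
    have := (Nat.lt_floor_add_one (y i)).le
    have h2 : θ m i * z ^ i = i * y i := by rw [hy]; field_simp
    rw [h2]
    nlinarith
  set F : ℕ := ∑ i ∈ Finset.Icc 1 J, i * ⌊y i⌋₊ with hF
  have hFcast : (F : ℝ) = ∑ i ∈ Finset.Icc 1 J, (i : ℝ) * ⌊y i⌋₊ := by
    rw [hF]; push_cast; rfl
  rw [← hFcast] at hfloor_le hfloor_ge
  rw [div_lt_iff₀ hV0] at hTlt hθ1
  have hNm := hN m
  have hFN : F ≤ N m := by
    have h1 : (F : ℝ) ≤ N m := by rw [hNm]; nlinarith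
    exact_mod_cast h1
  set n := N m - F with hn
  have hncast : (n : ℝ) = N m - F := by rw [hn]; push_cast [hFN]; ring
  have hJn : J < n := by
    have : (J : ℝ) < n := by rw [hncast, hNm]; nlinarith
    exact_mod_cast this
  have hn1 : (1 : ℝ) ≤ n := by exact_mod_cast (by omega : 1 ≤ n)
  have hgap := entropyGap_le (N := N m) (J := J) (n := n) hpos hz hJn (by change n + F = N m; omega)
  have e1 : ∑ i ∈ Finset.Icc (J + 1) (N m), y i ≤ δ / 4 * V m := by
    have h1 : ∑ i ∈ Finset.Icc (J + 1) (N m), y i ≤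
        θ m 1 * ∑ i ∈ Finset.Icc (J + 1) (N m), (i : ℝ) ^ (-γ - 1) := by
      rw [Finset.mul_sum]
      refine Finset.sum_le_sum fun i hi => ?_
      have hi1 : 1 ≤ i := by have := (Finset.mem_Icc.1 hi).1; omega
      have hi0 : (0 : ℝ) < i := by exact_mod_cast hi1
      rw [Real.rpow_sub_one hi0.ne', ← mul_div_assoc]
      have h := hup i hi1
      have h' := hpos i
      rw [hy]
      change θ m i * z ^ i / i ≤ _
      refine div_le_div_of_nonneg_right ?_ hi0.le
      calc θ m i * z ^ i ≤ θ m i * 1 :=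
            mul_le_mul_of_nonneg_left (pow_le_one₀ hz.le hz1) h'.le
        _ ≤ _ := by linarith
    have h2 := hs (Finset.Icc (J + 1) (N m)) (by
      rw [Finset.disjoint_left]
      intro i hi his
      have h1 := (Finset.mem_Icc.1 hi).1
      have h2 := hJs i his
      omega)
    have h3 := (le_abs_self _).trans_lt h2
    calc _ ≤ _ := h1
      _ ≤ ((c 1 + 1) * V m) * (δ / (4 * (c 1 + 1))) :=
          mul_le_mul hθ1.le h3.le (Finset.sum_nonneg fun i _ => by positivity) (by positivity)
      _ = _ := by field_simp
  have e2 : ∑ i ∈ Finset.Icc 1 J, (2 + Real.log (y i + 1)) ≤ δ / 4 * V m := by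
    calc _ ≤ ∑ i ∈ Finset.Icc 1 J, δ / (4 * (J + 1)) * V m := Finset.sum_le_sum hlogs
      _ = (J / (J + 1)) * (δ / 4 * V m) := by
          rw [Finset.sum_const, nsmul_eq_mul, Nat.card_Icc]; push_cast
          field_simp
      _ ≤ 1 * (δ / 4 * V m) := by
          refine mul_le_mul_of_nonneg_right ?_ (by positivity)
          rw [div_le_one (by positivity)]; linarith
      _ = _ := one_mul _
  have e3 : -Real.log (y n) ≤ δ / 4 * V m := by
    have h1 : (n : ℝ) ^ (-γ) * z ^ n / n ≤ y n := by
      have := hlow n (by omega)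
      rw [hy]; change _ ≤ θ m n * z ^ n / n
      gcongr
    have h2 := Real.log_le_log (by positivity) h1
    rw [Real.log_div (by positivity) (by positivity), Real.log_mul (by positivity)
      (by positivity), Real.log_rpow (by linarith), Real.log_pow] at h2
    have h3 : Real.log n ≤ Real.log (ρ * V m) := by
      refine Real.log_le_log (by linarith) ?_
      rw [hncast, hNm]; linarith [Nat.cast_nonneg (α := ℝ) F]
    have h4 : l = -Real.log z := by rw [hl, one_div, Real.log_inv]
    have h5 : (n : ℝ) * l ≤ δ / 8 * V m := by
      have h6 : (n : ℝ) ≤ (ρ - T m / V m + B / V m) * V m := by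
        rw [hncast, hNm]
        have : (ρ - T m / V m + B / V m) * V m = ρ * V m - T m + B := by field_simp
        rw [this]; linarith
      calc (n : ℝ) * l ≤ (ρ - T m / V m + B / V m) * V m * l :=
            mul_le_mul_of_nonneg_right h6 hl0
        _ = l * (ρ - T m / V m + B / V m) * V m := by ring
        _ ≤ δ / 8 * V m := mul_le_mul_of_nonneg_right hcost.le hV0.le
    have h7 : (γ + 1) * Real.log n ≤ δ / 8 * V m := by
      calc (γ + 1) * Real.log n ≤ (γ + 1) * (δ / (8 * (γ + 1)) * V m) :=
            mul_le_mul_of_nonneg_left (h3.trans hlogN) (by linarith)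
        _ = _ := by field_simp
    rw [show (n : ℝ) * Real.log z = -(n * l) by rw [h4]; ring] at h2
    linarith
  change _ ≤ ∑ i ∈ Finset.Icc (J + 1) (N m), y i +
      ∑ i ∈ Finset.Icc 1 J, (2 + Real.log (y i + 1)) - Real.log (y n) at hgap
  have : 0 < δ * V m := by positivity
  linarith

lemma tendsto_exp_sub_one_div : Tendsto (fun t : ℝ => (Real.exp t - 1) / t) (𝓝[≠] 0) (𝓝 1) := by
  have h := (hasDerivAt_iff_tendsto_slope.1 (Real.hasDerivAt_exp 0))
  rw [Real.exp_zero] at h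
  refine h.congr fun t => ?_
  rw [slope_def_field, Real.exp_zero, sub_zero]

lemma meanCount_tendsto {V : ℕ → ℝ} {N : ℕ → ℕ} (hV : Tendsto V atTop atTop)
    (hN : Tendsto N atTop atTop) {θ : ℕ → ℕ → ℝ} (hθpos : ∀ᶠ m in atTop, ∀ j, 0 < θ m j)
    {z : ℝ} (hz : 0 < z)
    (hgap : ∀ δ : ℝ, 0 < δ → ∀ᶠ m in atTop, entropyGap (θ m) z (N m) ≤ δ * V m)
    {j : ℕ} (hj : 1 ≤ j) {c : ℝ} (hθc : Tendsto (fun m => θ m j / V m) atTop (𝓝 c)) :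
    Tendsto (fun m => meanCount (θ m) (N m) j / V m) atTop (𝓝 (c * z ^ j / j)) := by
  set b := c * z ^ j / j with hb
  have hy : Tendsto (fun m => θ m j * z ^ j / j / V m) atTop (𝓝 b) := by
    refine ((hθc.mul_const (z ^ j)).div_const (j : ℝ)).congr fun m => by ring
  have hlim : Tendsto (fun t : ℝ => (Real.exp t - 1) / t * b) (𝓝[≠] 0) (𝓝 b) := by
    simpa using tendsto_exp_sub_one_div.mul_const b
  have hev : ∀ᶠ m in atTop, 0 < V m ∧ j ∈ Finset.Icc 1 (N m) ∧ ∀ i, 0 < θ m i := by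
    filter_upwards [hV.eventually_gt_atTop 0, hN.eventually_ge_atTop j, hθpos] with m h1 h2 h3
    exact ⟨h1, Finset.mem_Icc.2 ⟨hj, h2⟩, h3⟩
  rw [tendsto_order]
  constructor
  · intro a ha
    have h1 : ∀ᶠ t in 𝓝[<] (0 : ℝ), (a + b) / 2 < (Real.exp t - 1) / t * b :=
      (hlim.mono_left (nhdsWithin_mono _ fun t ht => ne_of_lt ht)).eventually_const_lt
        (by linarith)
    obtain ⟨t, ht1, ht0⟩ := (h1.and self_mem_nhdsWithin).exists
    filter_upwards [hev, (hy.const_mul ((Real.exp t - 1) / t)).eventually_const_lt ht1,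
      hgap (-t * ((b - a) / 2)) (by nlinarith)] with m ⟨hVm, hjm, hpos⟩ h3 h4
    have h5 := mul_meanCount_le hpos hz t hjm
    rw [lt_div_iff₀ hVm]
    have h6 : (a + b) / 2 * V m < (Real.exp t - 1) / t * (θ m j * z ^ j / j) := by
      have := mul_lt_mul_of_pos_right h3 hVm
      rwa [mul_assoc, div_mul_cancel₀ _ hVm.ne'] at this
    have h7 : t * ((Real.exp t - 1) / t * (θ m j * z ^ j / j)) =
        (Real.exp t - 1) * (θ m j * z ^ j / j) := by
      have htne : t ≠ 0 := ne_of_lt ht0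
      field_simp
    nlinarith
  · intro a ha
    have h1 : ∀ᶠ t in 𝓝[>] (0 : ℝ), (Real.exp t - 1) / t * b < (a + b) / 2 :=
      (hlim.mono_left (nhdsWithin_mono _ fun t ht => ne_of_gt ht)).eventually_lt_const
        (by linarith)
    obtain ⟨t, ht1, ht0⟩ := (h1.and self_mem_nhdsWithin).exists
    filter_upwards [hev, (hy.const_mul ((Real.exp t - 1) / t)).eventually_lt_const ht1,
      hgap (t * ((a - b) / 2)) (by nlinarith)] with m ⟨hVm, hjm, hpos⟩ h3 h4
    have h5 := mul_meanCount_le hpos hz t hjm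
    rw [div_lt_iff₀ hVm]
    have h6 : (Real.exp t - 1) / t * (θ m j * z ^ j / j) < (a + b) / 2 * V m := by
      have := mul_lt_mul_of_pos_right h3 hVm
      rwa [mul_assoc, div_mul_cancel₀ _ hVm.ne'] at this
    have h7 : t * ((Real.exp t - 1) / t * (θ m j * z ^ j / j)) =
        (Real.exp t - 1) * (θ m j * z ^ j / j) := by field_simp
    nlinarith

/-- The fugacity `z` at which the grand-canonical density equals `min ρ ρ_c`. -/
lemma exists_fugacity {c : ℕ → ℝ} (hc : ∀ j, 0 < c j) (hs : Summable c) {ρ : ℝ} (hρ : 0 < ρ) :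
    ∃ z : ℝ, 0 < z ∧ z ≤ 1 ∧ HasSum (fun j => c j * z ^ (j + 1)) (min ρ (∑' j, c j)) ∧
      (z = 1 ∨ min ρ (∑' j, c j) = ρ) := by
  rcases le_or_gt (∑' j, c j) ρ with h | h
  · refine ⟨1, one_pos, le_rfl, ?_, Or.inl rfl⟩
    rw [min_eq_right h]
    simpa using hs.hasSum
  · set F : ℝ → ℝ := fun z => ∑' j, c j * z ^ (j + 1) with hF
    have hle : ∀ j, ∀ z ∈ Set.Icc (0 : ℝ) 1, ‖c j * z ^ (j + 1)‖ ≤ c j := by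
      intro j z hz
      have h1 := pow_le_one₀ (n := j + 1) hz.1 hz.2
      rw [Real.norm_eq_abs, abs_of_nonneg (mul_nonneg (hc j).le (pow_nonneg hz.1 _))]
      nlinarith [hc j]
    have hcont : ContinuousOn F (Set.Icc 0 1) :=
      continuousOn_tsum (fun j => by fun_prop) hs hle
    have hF0 : F 0 = 0 := by simp [hF]
    have hF1 : F 1 = ∑' j, c j := by simp [hF]
    obtain ⟨z, hz, hFz⟩ := intermediate_value_Icc zero_le_one hcont
      (show ρ ∈ Set.Icc (F 0) (F 1) by rw [hF0, hF1]; exact ⟨hρ.le, h.le⟩)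
    have hz0 : z ≠ 0 := by rintro rfl; rw [hF0] at hFz; linarith
    refine ⟨z, lt_of_le_of_ne hz.1 hz0.symm, hz.2, ?_, Or.inr (min_eq_left h.le)⟩
    rw [min_eq_left h.le, ← hFz]
    exact (hs.of_norm_bounded fun j => hle j z hz).hasSum

lemma mean_long_cycles {N K : ℕ} {θ : ℕ → ℝ} (hθ : ∀ j, 0 < θ j) (hN : 0 < N) (hK : K ≤ N) :
    (∑ π : Equiv.Perm (Fin N), cycWeight θ π *
        ((∑ j ∈ Finset.Icc (K + 1) N, (j : ℝ) * cycCount π j) / N)) /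
      (∑ π : Equiv.Perm (Fin N), cycWeight θ π) =
    1 - ∑ j ∈ Finset.Icc 1 K, j * meanCount θ N j / N := by
  have hZ := sum_cycWeight_pos (N := N) hθ
  have hN' : (N : ℝ) ≠ 0 := by positivity
  have hsplit : Finset.Icc 1 N = Finset.Icc 1 K ∪ Finset.Icc (K + 1) N := by
    ext i; simp; omega
  have hdisj : Disjoint (Finset.Icc 1 K) (Finset.Icc (K + 1) N) := by
    rw [Finset.disjoint_left]; intro i; simp; omega
  have h1 : ∀ π : Equiv.Perm (Fin N), ∑ j ∈ Finset.Icc (K + 1) N, (j : ℝ) * cycCount π j =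
      N - ∑ j ∈ Finset.Icc 1 K, (j : ℝ) * cycCount π j := by
    intro π
    have h := congrArg (Nat.cast (R := ℝ)) (sum_mul_cycCount π)
    rw [hsplit, Finset.sum_union hdisj] at h
    push_cast at h
    linarith
  simp_rw [h1]
  rw [div_eq_iff hZ.ne', sub_mul, one_mul, Finset.sum_mul]
  have h2 : ∀ j : ℕ, (j : ℝ) * meanCount θ N j / N * ∑ π : Equiv.Perm (Fin N), cycWeight θ π =
      ∑ π : Equiv.Perm (Fin N), cycWeight θ π * (j * cycCount π j / N) := by
    intro j
    rw [meanCount, mul_div_assoc', div_div, div_mul_eq_mul_div, mul_comm (∑ π, _) (N : ℝ),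
      mul_div_mul_right _ _ hZ.ne', Finset.mul_sum, Finset.sum_div]
    exact Finset.sum_congr rfl fun π _ => by ring
  simp_rw [h2]
  rw [Finset.sum_comm, ← Finset.sum_sub_distrib]
  refine Finset.sum_congr rfl fun π _ => ?_
  rw [← Finset.mul_sum, ← Finset.sum_div]
  field_simp

/-- The fraction of points in infinite cycles for permutations with cycle weights `θ`. -/
lemma tendsto_liminf_long_cycles {γ ρ : ℝ} (hγ : 0 < γ) (hρ : 0 < ρ) {V : ℕ → ℝ} {N : ℕ → ℕ}
    (hV : Tendsto V atTop atTop) (hN : ∀ m, (N m : ℝ) = ρ * V m)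
    {θ : ℕ → ℕ → ℝ} {c : ℕ → ℝ} (hc : ∀ j, 1 ≤ j → 0 < c j)
    (hcs : Summable fun j => c (j + 1))
    (hθc : ∀ j, 1 ≤ j → Tendsto (fun m => θ m j / V m) atTop (𝓝 (c j)))
    (hθpos : ∀ᶠ m in atTop, ∀ j, 0 < θ m j)
    (hθlow : ∀ᶠ m in atTop, ∀ j : ℕ, 1 ≤ j → (j : ℝ) ^ (-γ) ≤ θ m j)
    (hθup : ∀ᶠ m in atTop, ∀ j : ℕ, 1 ≤ j → θ m j ≤ (j : ℝ) ^ (-γ) * θ m 1)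
    {E : ℕ → ℕ → ℝ} (hE : ∀ K, ∀ᶠ m in atTop, E K m =
      (∑ π : Equiv.Perm (Fin (N m)), cycWeight (θ m) π *
        ((∑ j ∈ Finset.Icc (K + 1) (N m), (j : ℝ) * cycCount π j) / N m)) /
      (∑ π : Equiv.Perm (Fin (N m)), cycWeight (θ m) π)) :
    Tendsto (fun K => liminf (E K) atTop) atTop
      (𝓝 (max 0 (1 - (∑' j, c (j + 1)) / ρ))) := by
  obtain ⟨z, hz, hz1, hR, hzR⟩ := exists_fugacity (fun j => hc (j + 1) (by omega)) hcs hρ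
  set R := min ρ (∑' j, c (j + 1)) with hRdef
  have hgap : ∀ δ : ℝ, 0 < δ → ∀ᶠ m in atTop, entropyGap (θ m) z (N m) ≤ δ * V m :=
    fun δ hδ => entropyGap_le_mul hγ hρ hV hN hc hθc hθpos hθlow hθup hz hz1 hR
      (min_le_left _ _) hzR hδ
  have hNtop : Tendsto N atTop atTop := by
    rw [← tendsto_natCast_atTop_iff (R := ℝ)]
    simp_rw [hN]
    exact hV.const_mul_atTop hρ
  have hlim : ∀ K, Tendsto (E K) atTop
      (𝓝 (1 - (∑ i ∈ Finset.range K, c (i + 1) * z ^ (i + 1)) / ρ)) := by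
    intro K
    have h1 : Tendsto (fun m => 1 - ∑ j ∈ Finset.Icc 1 K, (j : ℝ) *
        (meanCount (θ m) (N m) j / V m) / ρ) atTop
        (𝓝 (1 - ∑ j ∈ Finset.Icc 1 K, (j : ℝ) * (c j * z ^ j / j) / ρ)) := by
      refine tendsto_const_nhds.sub (tendsto_finsetSum _ fun j hj => ?_)
      have hj1 := (Finset.mem_Icc.1 hj).1
      exact ((meanCount_tendsto hV hNtop hθpos hz hgap hj1 (hθc j hj1)).const_mul _).div_const _
    have h2 : ∑ j ∈ Finset.Icc 1 K, (j : ℝ) * (c j * z ^ j / j) / ρ =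
        (∑ i ∈ Finset.range K, c (i + 1) * z ^ (i + 1)) / ρ := by
      rw [Finset.range_eq_Ico, Finset.sum_Ico_add' (fun i => c i * z ^ i) 0 K 1, Finset.sum_div]
      refine Finset.sum_congr rfl fun j hj => ?_
      have : (j : ℝ) ≠ 0 := by
        have := (Finset.mem_Icc.1 hj).1
        positivity
      field_simp
    rw [h2] at h1
    refine h1.congr' ?_
    filter_upwards [hE K, hθpos, hNtop.eventually_ge_atTop (K + 1),
      hV.eventually_gt_atTop 0] with m hEm hpos hNm hVm
    rw [hEm, mean_long_cycles hpos (by omega) (by omega)]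
    congr 1
    refine Finset.sum_congr rfl fun j _ => ?_
    rw [hN]
    field_simp
  have hfinal : max 0 (1 - (∑' j, c (j + 1)) / ρ) = 1 - R / ρ := by
    rcases le_total ρ (∑' j, c (j + 1)) with h | h
    · rw [hRdef, min_eq_left h, div_self hρ.ne', sub_self, max_eq_left]
      rw [sub_nonpos, le_div_iff₀ hρ]; linarith
    · rw [hRdef, min_eq_right h, max_eq_right]
      rw [sub_nonneg, div_le_iff₀ hρ]; linarith
  rw [hfinal]
  simp_rw [fun K => (hlim K).liminf_eq]
  exact tendsto_const_nhds.sub (hR.tendsto_sum_nat.div_const ρ)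

lemma tendsto_integral_gaussian_smul_fourier {V : Type*} [NormedAddCommGroup V]
    [InnerProductSpace ℝ V] [MeasurableSpace V] [BorelSpace V] [FiniteDimensional ℝ V]
    {F : V → ℂ} (hF : Integrable F) (hc : ContinuousAt F 0) :
    Tendsto (fun c : ℝ => ∫ w : V, Complex.exp (-(c : ℂ)⁻¹ * ‖w‖ ^ 2) • 𝓕 F w) atTop
      (𝓝 (F 0)) := by
  refine (Real.tendsto_integral_gaussian_smul' hF hc).congr' ?_
  filter_upwards [Ioi_mem_atTop 0] with c (hc : 0 < c)
  have J : Integrable (fun w : V =>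
      Complex.exp (-(c : ℂ)⁻¹ * ‖w‖ ^ 2 + (0 : ℂ) * (inner ℝ (0 : V) w : ℝ))) :=
    GaussianFourier.integrable_cexp_neg_mul_sq_norm_add
      (by rw [← Complex.ofReal_inv, Complex.ofReal_re]; positivity) _ _
  simp only [zero_mul, add_zero] at J
  have h := VectorFourier.integral_fourierIntegral_smul_eq_flip (L := innerₗ V)
      Real.continuous_fourierChar continuous_inner J hF
  have h2 : ∀ w : V, VectorFourier.fourierIntegral Real.fourierChar volume (innerₗ V)
      (fun w : V => Complex.exp (-(c : ℂ)⁻¹ * ‖w‖ ^ 2)) w =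
      ((Real.pi * c : ℂ) ^ (Module.finrank ℝ V / 2 : ℂ) *
        Complex.exp (-Real.pi ^ 2 * c * ‖(0 : V) - w‖ ^ 2)) := by
    intro w
    have := fourier_gaussian_innerProductSpace (V := V) (b := (c : ℂ)⁻¹)
      (by rw [← Complex.ofReal_inv, Complex.ofReal_re]; positivity) w
    rw [zero_sub, norm_neg]
    refine Eq.trans ?_ (this.trans ?_)
    · rfl
    · congr 2
      · simp
      · simp; ring
  simp_rw [h2] at h
  exact h.trans (by simp only [flip_innerₗ]; rfl)

/-- A continuous integrable function with nonnegative Fourier transform has an integrable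
Fourier transform. -/
lemma integrable_of_fourier_eq_nonneg {V : Type*} [NormedAddCommGroup V]
    [InnerProductSpace ℝ V] [MeasurableSpace V] [BorelSpace V] [FiniteDimensional ℝ V]
    {F : V → ℂ} (hF : Integrable F) (hc : ContinuousAt F 0) {g : V → ℝ} (hg : Continuous g)
    (hg0 : ∀ k, 0 ≤ g k) (hbd : ∀ k, g k ≤ 1) (hFg : ∀ k, 𝓕 F k = (g k : ℂ)) :
    Integrable g := by
  have ht := tendsto_integral_gaussian_smul_fourier hF hc
  simp_rw [hFg] at ht
  set G : ℕ → V → ℝ := fun n k => Real.exp (-((n : ℝ)⁻¹ * ‖k‖ ^ 2)) * g k with hG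
  have h1 : Tendsto (fun n : ℕ => ∫ k, G n k) atTop (𝓝 (F 0).re) := by
    refine ((Complex.continuous_re.tendsto _).comp
      (ht.comp tendsto_natCast_atTop_atTop)).congr fun n => ?_
    have : ∀ w : V, Complex.exp (-((n : ℝ) : ℂ)⁻¹ * ‖w‖ ^ 2) • (g w : ℂ) = ((G n w : ℝ) : ℂ) := by
      intro w
      simp [hG]
    simp only [Function.comp_apply]
    simp_rw [this]
    rw [integral_complex_ofReal, Complex.ofReal_re]
  have hGint : ∀ n : ℕ, 0 < n → Integrable (G n) := by
    intro n hn
    have h0 : Integrable (fun k : V => Real.exp (-((n : ℝ)⁻¹ * ‖k‖ ^ 2))) := by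
      have := GaussianFourier.integrable_cexp_neg_mul_sq_norm_add (V := V) (b := ((n : ℝ) : ℂ)⁻¹)
        (by rw [← Complex.ofReal_inv, Complex.ofReal_re]; positivity) 0 0
      refine this.re.congr (ae_of_all _ fun k => ?_)
      simp only [zero_mul, add_zero]
      rw [← Complex.ofReal_inv, ← Complex.ofReal_pow, ← Complex.ofReal_neg, ← Complex.ofReal_mul,
        ← Complex.ofReal_exp, ← neg_mul]
      exact Complex.ofReal_re _
    refine h0.mono' (by fun_prop) (ae_of_all _ fun k => ?_)
    rw [Real.norm_eq_abs, abs_of_nonneg (mul_nonneg (Real.exp_pos _).le (hg0 k))]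
    exact mul_le_of_le_one_right (Real.exp_pos _).le (hbd k)
  have hfatou : ∫⁻ k, ENNReal.ofReal (g k) ≤ ENNReal.ofReal (F 0).re := by
    have hlim : ∀ k, Tendsto (fun n : ℕ => ENNReal.ofReal (G n k)) atTop
        (𝓝 (ENNReal.ofReal (g k))) := by
      intro k
      refine (ENNReal.continuous_ofReal.tendsto _).comp ?_
      have : Tendsto (fun n : ℕ => Real.exp (-((n : ℝ)⁻¹ * ‖k‖ ^ 2)) * g k) atTop
          (𝓝 (Real.exp (-(0 * ‖k‖ ^ 2)) * g k)) :=
        ((Real.continuous_exp.tendsto _).comp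
          ((tendsto_inv_atTop_nhds_zero_nat.mul_const _).neg)).mul_const _
      simpa using this
    calc ∫⁻ k, ENNReal.ofReal (g k)
        = ∫⁻ k, liminf (fun n : ℕ => ENNReal.ofReal (G n k)) atTop :=
          lintegral_congr fun k => (hlim k).liminf_eq.symm
      _ ≤ liminf (fun n : ℕ => ∫⁻ k, ENNReal.ofReal (G n k)) atTop :=
          lintegral_liminf_le fun n => by
            have : Continuous (G n) := by fun_prop
            exact this.measurable.ennreal_ofReal
      _ = ENNReal.ofReal (F 0).re := by
          refine Tendsto.liminf_eq (((ENNReal.continuous_ofReal.tendsto _).comp h1).congr' ?_)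
          filter_upwards [eventually_gt_atTop 0] with n hn
          exact ofReal_integral_eq_lintegral_ofReal (hGint n hn)
            (ae_of_all _ fun k => mul_nonneg (Real.exp_pos _).le (hg0 k))
  refine ⟨hg.aestronglyMeasurable, ?_⟩
  rw [hasFiniteIntegral_iff_ofReal (ae_of_all _ hg0)]
  exact hfatou.trans_lt ENNReal.ofReal_lt_top

lemma integrable_indicator_norm_rpow_neg {E : Type*} [NormedAddCommGroup E] [NormedSpace ℝ E]
    [MeasurableSpace E] [BorelSpace E] [FiniteDimensional ℝ E] [Nontrivial E] (μ : Measure E)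
    [μ.IsAddHaarMeasure] {η : ℝ} (hη : η < Module.finrank ℝ E) :
    Integrable (fun x : E => Set.indicator (Set.Iic 1) (fun r : ℝ => r ^ (-η)) ‖x‖) μ := by
  rw [integrable_fun_norm_addHaar μ (f := Set.indicator (Set.Iic 1) (fun r : ℝ => r ^ (-η)))]
  have h1 : IntegrableOn (fun r : ℝ => r ^ ((Module.finrank ℝ E : ℝ) - 1 - η)) (Set.Ioc 0 1) := by
    rw [← intervalIntegrable_iff_integrableOn_Ioc_of_le zero_le_one]
    exact intervalIntegral.intervalIntegrable_rpow' (by linarith)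
  have h2 : IntegrableOn (Set.indicator (Set.Iic 1)
      (fun r : ℝ => r ^ ((Module.finrank ℝ E : ℝ) - 1 - η))) (Set.Ioi 0) := by
    rw [IntegrableOn, integrable_indicator_iff measurableSet_Iic, IntegrableOn,
      Measure.restrict_restrict measurableSet_Iic, Set.inter_comm, Set.Ioi_inter_Iic]
    exact h1
  refine h2.congr_fun (fun r hr => ?_) measurableSet_Ioi
  have hr0 : 0 < r := hr
  by_cases h : r ≤ 1
  · rw [Set.indicator_of_mem (show r ∈ Set.Iic 1 from h),
      Set.indicator_of_mem (show r ∈ Set.Iic 1 from h), smul_eq_mul, sub_eq_add_neg _ η,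
      Real.rpow_add hr0, ← Real.rpow_natCast, Nat.cast_pred Module.finrank_pos]
  · simp [show r ∉ Set.Iic 1 from h]

lemma sum_exp_neg_mul_le {t : ℝ} (ht : 0 < t) (n : ℕ) :
    ∑ j ∈ Finset.range n, Real.exp (-(((j : ℝ) + 1) * t)) ≤
      Real.exp (-t) / (1 - Real.exp (-t)) := by
  have hlt : Real.exp (-t) < 1 := by rw [Real.exp_lt_one_iff]; linarith
  have h1 : ∀ j : ℕ, Real.exp (-(((j : ℝ) + 1) * t)) = Real.exp (-t) * Real.exp (-t) ^ j := by
    intro j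
    rw [← Real.exp_nat_mul, ← Real.exp_add]
    ring_nf
  simp_rw [h1]
  rw [← Finset.mul_sum, div_eq_mul_inv]
  refine mul_le_mul_of_nonneg_left ?_ (Real.exp_pos _).le
  rw [← tsum_geometric_of_lt_one (Real.exp_pos _).le hlt]
  exact (summable_geometric_of_lt_one (Real.exp_pos _).le hlt).sum_le_tsum _
    fun j _ => (pow_pos (Real.exp_pos _) _).le

lemma summable_integral_exp_neg {d : ℕ} (hd : 1 ≤ d) {ε : Eu d → ℝ}
    (hε_nonneg : ∀ k, 0 ≤ ε k) (hcont : Continuous fun k => Real.exp (-ε k))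
    (hint : Integrable fun k => Real.exp (-ε k))
    (hε_low : ∃ a > (0:ℝ), ∃ η : ℝ, 0 < η ∧ η < d ∧
      ∀ k : Eu d, ‖k‖ ≤ 1 → a * ‖k‖ ^ η ≤ ε k)
    (hε_pos : ∀ δ : ℝ, 0 < δ → ∃ c > (0:ℝ), ∀ k : Eu d, δ ≤ ‖k‖ → c ≤ ε k) :
    Summable fun j : ℕ => ∫ k, Real.exp (-(((j : ℝ) + 1) * ε k)) := by
  obtain ⟨a, ha, η, hη, hηd, hlow⟩ := hε_low
  obtain ⟨c, hc, hpos⟩ := hε_pos 1 one_pos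
  have : Nonempty (Fin d) := ⟨⟨0, hd⟩⟩
  have : Nontrivial (Eu d) := by
    apply Module.nontrivial_of_finrank_pos (R := ℝ)
    simp; omega
  have hcl : Real.exp (-c) < 1 := by rw [Real.exp_lt_one_iff]; linarith
  set B : Eu d → ℝ := fun k => a⁻¹ * Set.indicator (Set.Iic 1) (fun r : ℝ => r ^ (-η)) ‖k‖ +
    (1 - Real.exp (-c))⁻¹ * Real.exp (-ε k) with hB
  have hBint : Integrable B :=
    ((integrable_indicator_norm_rpow_neg volume (by simpa using hηd)).const_mul _).add
      (hint.const_mul _)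
  have hle : ∀ j : ℕ, ∀ k, Real.exp (-(((j : ℝ) + 1) * ε k)) ≤ Real.exp (-ε k) := by
    intro j k
    have : (0 : ℝ) ≤ j := j.cast_nonneg
    exact Real.exp_le_exp.2 (by nlinarith [hε_nonneg k])
  have hjint : ∀ j : ℕ, Integrable fun k => Real.exp (-(((j : ℝ) + 1) * ε k)) := by
    intro j
    refine hint.mono' ?_ (ae_of_all _ fun k => ?_)
    · have : (fun k => Real.exp (-(((j : ℝ) + 1) * ε k))) =
          fun k => Real.exp (-ε k) ^ (j + 1) := by
        ext k
        rw [← Real.exp_nat_mul]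
        push_cast
        ring_nf
      rw [this]
      exact (hcont.pow _).aestronglyMeasurable
    · rw [Real.norm_eq_abs, abs_of_pos (Real.exp_pos _)]
      exact hle j k
  refine summable_of_sum_range_le (c := ∫ k, B k)
    (fun j => integral_nonneg fun k => (Real.exp_pos _).le) fun n => ?_
  rw [← integral_finsetSum _ fun j _ => hjint j]
  refine integral_mono_ae (integrable_finsetSum _ fun j _ => hjint j) hBint ?_
  have hne : ∀ᵐ k : Eu d, k ≠ 0 := by
    rw [ae_iff]
    simp
  filter_upwards [hne] with k hk
  have hk0 : 0 < ‖k‖ := norm_pos_iff.2 hk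
  have hi1 : 0 ≤ Set.indicator (Set.Iic 1) (fun r : ℝ => r ^ (-η)) ‖k‖ :=
    Set.indicator_apply_nonneg fun _ => Real.rpow_nonneg hk0.le _
  have hi2 : 0 ≤ (1 - Real.exp (-c))⁻¹ * Real.exp (-ε k) :=
    mul_nonneg (inv_nonneg.2 (by linarith)) (Real.exp_pos _).le
  rcases le_or_gt ‖k‖ 1 with h | h
  · have hp : 0 < a * ‖k‖ ^ η := mul_pos ha (Real.rpow_pos_of_pos hk0 _)
    have hεk := hlow k h
    refine (sum_exp_neg_mul_le (hp.trans_le hεk) n).trans ?_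
    have h1 : Real.exp (-ε k) / (1 - Real.exp (-ε k)) ≤ (ε k)⁻¹ := by
      have h0 : 0 < ε k := hp.trans_le hεk
      have h2 : Real.exp (-ε k) < 1 := by rw [Real.exp_lt_one_iff]; linarith
      rw [inv_eq_one_div, div_le_div_iff₀ (by linarith) h0]
      have h3 := Real.add_one_le_exp (ε k)
      have h4 : Real.exp (-ε k) * Real.exp (ε k) = 1 := by
        rw [← Real.exp_add]; simp
      nlinarith [Real.exp_pos (-ε k)]
    have h2 : (ε k)⁻¹ ≤ a⁻¹ * ‖k‖ ^ (-η) := by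
      rw [Real.rpow_neg hk0.le, ← mul_inv]
      exact inv_anti₀ hp hεk
    simp only [hB]
    rw [Set.indicator_of_mem (show ‖k‖ ∈ Set.Iic 1 from h)]
    linarith
  · have hεk := hpos k h.le
    refine (sum_exp_neg_mul_le (hc.trans_le hεk) n).trans ?_
    have h1 : Real.exp (-ε k) / (1 - Real.exp (-ε k)) ≤
        (1 - Real.exp (-c))⁻¹ * Real.exp (-ε k) := by
      rw [div_eq_mul_inv, mul_comm]
      refine mul_le_mul_of_nonneg_right (inv_anti₀ (by linarith) ?_) (Real.exp_pos _).le
      have := Real.exp_le_exp.2 (neg_le_neg hεk)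
      linarith
    have : 0 ≤ a⁻¹ * Set.indicator (Set.Iic 1) (fun r : ℝ => r ^ (-η)) ‖k‖ :=
      mul_nonneg (inv_nonneg.2 ha.le) hi1
    simp only [hB]
    linarith

/-- The cell of the dual lattice containing `k`. -/
def dualFloor (d : ℕ) (L : ℝ) (k : Eu d) : Fin d → ℤ := fun i => ⌊L * k i⌋

lemma measurable_dualFloor (d : ℕ) (L : ℝ) : Measurable (dualFloor d L) := by
  refine measurable_pi_lambda _ fun i => Int.measurable_floor.comp ?_
  fun_prop

lemma volume_dualFloor_fiber (d : ℕ) {L : ℝ} (hL : 0 < L) (z : Fin d → ℤ) :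
    volume (dualFloor d L ⁻¹' {z}) = ENNReal.ofReal ((L ^ d)⁻¹) := by
  have h1 : dualFloor d L ⁻¹' {z} = WithLp.ofLp ⁻¹'
      (Set.univ.pi fun i => Set.Ico ((z i : ℝ) / L) (((z i : ℝ) + 1) / L)) := by
    ext k
    simp only [Set.mem_preimage, Set.mem_singleton_iff, Set.mem_univ_pi, Set.mem_Ico, dualFloor,
      funext_iff, Int.floor_eq_iff, div_le_iff₀ hL, lt_div_iff₀ hL, mul_comm L]
  rw [h1, (PiLp.volume_preserving_ofLp (Fin d)).measure_preimage
    (MeasurableSet.univ_pi fun i => measurableSet_Ico).nullMeasurableSet, Real.volume_pi_Ico]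
  have h2 : ∀ i, ((z i : ℝ) + 1) / L - (z i : ℝ) / L = L⁻¹ := fun i => by field_simp; ring
  simp_rw [h2]
  rw [Finset.prod_const, Finset.card_univ, Fintype.card_fin, ← ENNReal.ofReal_pow (by positivity),
    inv_pow]

lemma lintegral_dualFloor (d : ℕ) {L : ℝ} (hL : 0 < L) (h : Eu d → ℝ≥0∞) :
    ∫⁻ k, h (dualPt d L (dualFloor d L k)) =
      ENNReal.ofReal ((L ^ d)⁻¹) * ∑' z, h (dualPt d L z) := by
  rw [← lintegral_map (f := fun z => h (dualPt d L z)) (measurable_of_countable _)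
    (measurable_dualFloor d L), lintegral_countable', ← ENNReal.tsum_mul_left]
  refine tsum_congr fun z => ?_
  rw [Measure.map_apply (measurable_dualFloor d L) (measurableSet_singleton z),
    volume_dualFloor_fiber d hL, mul_comm]

lemma tendsto_dualPt_dualFloor (d : ℕ) {Ls : ℕ → ℝ} (hLs : Tendsto Ls atTop atTop) (k : Eu d) :
    Tendsto (fun m => dualPt d (Ls m) (dualFloor d (Ls m) k)) atTop (𝓝 k) := by
  have h : Tendsto (fun m => fun i : Fin d => (⌊Ls m * k i⌋ : ℝ) / Ls m) atTop
      (𝓝 (WithLp.ofLp k)) := by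
    rw [tendsto_pi_nhds]
    intro i
    have h1 := (tendsto_inv_atTop_zero.comp hLs)
    have h2 : Tendsto (fun m => k i - (Ls m)⁻¹) atTop (𝓝 (k i - 0)) := h1.const_sub _
    rw [sub_zero] at h2
    refine tendsto_of_tendsto_of_tendsto_of_le_of_le' h2 tendsto_const_nhds ?_ ?_
    · filter_upwards [hLs.eventually_gt_atTop 0] with m hm
      rw [le_div_iff₀ hm, sub_mul, inv_mul_cancel₀ hm.ne']
      have := Int.lt_floor_add_one (Ls m * k i)
      linarith
    · filter_upwards [hLs.eventually_gt_atTop 0] with m hm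
      rw [div_le_iff₀ hm]
      have := Int.floor_le (Ls m * k i)
      linarith
  exact ((PiLp.continuous_toLp 2 _).tendsto _).comp h

lemma eventually_lt_riemann_sum {d : ℕ} {Ls : ℕ → ℝ} (hLs : Tendsto Ls atTop atTop)
    {h : Eu d → ℝ} (hc : Continuous h) (h0 : ∀ k, 0 ≤ h k) (hi : Integrable h)
    (hs : ∀ᶠ m in atTop, Summable fun z => h (dualPt d (Ls m) z)) {r : ℝ}
    (hr : r < ∫ k, h k) :
    ∀ᶠ m in atTop, r < (Ls m ^ d)⁻¹ * ∑' z, h (dualPt d (Ls m) z) := by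
  rcases lt_or_ge r 0 with hr0 | hr0
  · filter_upwards [hLs.eventually_gt_atTop 0] with m hm
    exact hr0.trans_le (mul_nonneg (by positivity) (tsum_nonneg fun z => h0 _))
  have hlim : ∀ k, Tendsto (fun m => ENNReal.ofReal (h (dualPt d (Ls m) (dualFloor d (Ls m) k))))
      atTop (𝓝 (ENNReal.ofReal (h k))) := fun k =>
    (ENNReal.continuous_ofReal.tendsto _).comp ((hc.tendsto k).comp
      (tendsto_dualPt_dualFloor d hLs k))
  have h1 : ENNReal.ofReal r < liminf (fun m =>
      ∫⁻ k, ENNReal.ofReal (h (dualPt d (Ls m) (dualFloor d (Ls m) k)))) atTop := by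
    calc ENNReal.ofReal r < ENNReal.ofReal (∫ k, h k) :=
          (ENNReal.ofReal_lt_ofReal_iff_of_nonneg hr0).2 hr
      _ = ∫⁻ k, ENNReal.ofReal (h k) := ofReal_integral_eq_lintegral_ofReal hi (ae_of_all _ h0)
      _ = ∫⁻ k, liminf (fun m =>
            ENNReal.ofReal (h (dualPt d (Ls m) (dualFloor d (Ls m) k)))) atTop :=
          lintegral_congr fun k => (hlim k).liminf_eq.symm
      _ ≤ _ := lintegral_liminf_le fun m =>
          ENNReal.measurable_ofReal.comp ((measurable_of_countable
            fun z => h (dualPt d (Ls m) z)).comp (measurable_dualFloor d (Ls m)))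
  filter_upwards [eventually_lt_of_lt_liminf h1, hs, hLs.eventually_gt_atTop 0] with m hm hsm hLm
  rw [lintegral_dualFloor d hLm fun k => ENNReal.ofReal (h k),
    ← ENNReal.ofReal_tsum_of_nonneg (fun z => h0 _) hsm,
    ← ENNReal.ofReal_mul (by positivity)] at hm
  exact (ENNReal.ofReal_lt_ofReal_iff_of_nonneg hr0).1 hm

lemma tendsto_riemann_sum_of_le {d : ℕ} {Ls : ℕ → ℝ} (hLs : Tendsto Ls atTop atTop)
    {g h : Eu d → ℝ} (hg : Continuous g) (hgi : Integrable g)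
    (hgs : ∀ᶠ m in atTop, Summable fun z => g (dualPt d (Ls m) z))
    (hR : Tendsto (fun m => (Ls m ^ d)⁻¹ * ∑' z, g (dualPt d (Ls m) z)) atTop (𝓝 (∫ k, g k)))
    (hc : Continuous h) (h0 : ∀ k, 0 ≤ h k) (hle : ∀ k, h k ≤ g k) :
    Tendsto (fun m => (Ls m ^ d)⁻¹ * ∑' z, h (dualPt d (Ls m) z)) atTop (𝓝 (∫ k, h k)) := by
  have hi : Integrable h := hgi.mono' hc.aestronglyMeasurable (ae_of_all _ fun k => by
    rw [Real.norm_eq_abs, abs_of_nonneg (h0 k)]; exact hle k)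
  have hs : ∀ᶠ m in atTop, Summable fun z => h (dualPt d (Ls m) z) := by
    filter_upwards [hgs] with m hm
    exact hm.of_nonneg_of_le (fun z => h0 _) fun z => hle _
  rw [tendsto_order]
  refine ⟨fun a ha => eventually_lt_riemann_sum hLs hc h0 hi hs ha, fun a ha => ?_⟩
  have h1 := eventually_lt_riemann_sum hLs (hg.sub hc) (fun k => sub_nonneg.2 (hle k))
    (hgi.sub hi) (by filter_upwards [hgs, hs] with m h1 h2 using h1.sub h2)
    (r := (∫ k, g k) - (∫ k, h k) - (a - ∫ k, h k) / 2)
    (by rw [integral_sub' hgi hi]; linarith)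
  filter_upwards [h1, hgs, hs, hR.eventually_lt_const
    (show ∫ k, g k < (∫ k, g k) + (a - ∫ k, h k) / 2 by linarith)] with m h2 h3 h4 h5
  simp only [Pi.sub_apply] at h2
  rw [h3.tsum_sub h4, mul_sub] at h2
  linarith

lemma eventually_summable_of_tendsto_riemann_sum {d : ℕ} {Ls : ℕ → ℝ} {g : Eu d → ℝ} {I : ℝ}
    (hI : 0 < I)
    (hR : Tendsto (fun m => (Ls m ^ d)⁻¹ * ∑' z, g (dualPt d (Ls m) z)) atTop (𝓝 I)) :
    ∀ᶠ m in atTop, Summable fun z => g (dualPt d (Ls m) z) := by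
  filter_upwards [hR.eventually_const_lt hI] with m hm
  by_contra h
  rw [tsum_eq_zero_of_not_summable h, mul_zero] at hm
  exact lt_irrefl _ hm

/-- The normalized Haar measure on the torus. -/
def torusHaar (d : ℕ) : Measure (UnitAddTorus (Fin d)) :=
  Measure.pi fun _ => AddCircle.haarAddCircle

instance (d : ℕ) : IsProbabilityMeasure (torusHaar d) := by
  unfold torusHaar; infer_instance

instance (d : ℕ) : (torusHaar d).IsOpenPosMeasure := by
  unfold torusHaar; infer_instance

/-- The covering map of the torus `ℝ^d / Lℤ^d`, rescaled to the unit torus. -/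
def toTorus (d : ℕ) (L : ℝ) (x : Eu d) : UnitAddTorus (Fin d) :=
  fun i => ((x i / L : ℝ) : UnitAddCircle)

lemma continuous_toTorus (d : ℕ) (L : ℝ) : Continuous (toTorus d L) := by
  refine continuous_pi fun i => (AddCircle.continuous_mk' 1).comp ?_
  fun_prop

lemma toTorus_sub (d : ℕ) (L : ℝ) (x y : Eu d) :
    toTorus d L (x - y) = toTorus d L x - toTorus d L y := by
  ext i
  simp [toTorus, sub_div]

lemma toTorus_latPt (d : ℕ) {L : ℝ} (hL : L ≠ 0) (z : Fin d → ℤ) :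
    toTorus d L (latPt d L z) = 0 := by
  ext i
  simp only [toTorus, latPt, WithLp.equiv_symm_apply, Pi.zero_apply]
  rw [mul_div_cancel_left₀ _ hL]
  exact (AddCircle.coe_eq_zero_iff 1).2 ⟨z i, by simp⟩

lemma toTorus_sub_latPt (d : ℕ) {L : ℝ} (hL : L ≠ 0) (x : Eu d) (z : Fin d → ℤ) :
    toTorus d L (x - latPt d L z) = toTorus d L x := by
  rw [toTorus_sub, toTorus_latPt d hL, sub_zero]

lemma isOpenQuotientMap_toTorus (d : ℕ) {L : ℝ} (hL : L ≠ 0) :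
    IsOpenQuotientMap (toTorus d L) := by
  have h1 : IsOpenQuotientMap (fun x : ℝ => ((x / L : ℝ) : UnitAddCircle)) := by
    have := (QuotientAddGroup.isOpenQuotientMap_mk (N := AddSubgroup.zmultiples (1 : ℝ)))
    have h := this.comp (Homeomorph.mulRight₀ L⁻¹ (inv_ne_zero hL)).isOpenQuotientMap
    simpa only [div_eq_mul_inv] using! h
  exact (IsOpenQuotientMap.piMap fun _ : Fin d => h1).comp
    (EuclideanSpace.equiv (Fin d) ℝ).toHomeomorph.isOpenQuotientMap

lemma exists_latPt_of_toTorus_eq (d : ℕ) {L : ℝ} (hL : L ≠ 0) {x y : Eu d}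
    (h : toTorus d L x = toTorus d L y) : ∃ z, x = y - latPt d L z := by
  have h1 : ∀ i, ∃ n : ℤ, y i - x i = L * n := by
    intro i
    have h2 : ((y i / L - x i / L : ℝ) : UnitAddCircle) = 0 := by
      rw [AddCircle.coe_sub, sub_eq_zero]
      exact (congrFun h i).symm
    obtain ⟨n, hn⟩ := (AddCircle.coe_eq_zero_iff 1).1 h2
    refine ⟨n, ?_⟩
    rw [zsmul_eq_mul, mul_one] at hn
    rw [hn]
    field_simp
  choose z hz using h1
  refine ⟨z, ?_⟩
  ext i
  simp only [latPt, WithLp.equiv_symm_apply, PiLp.sub_apply]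
  linarith [hz i]

lemma map_circle_restrict_Ico {L : ℝ} (hL : 0 < L) :
    Measure.map (fun x : ℝ => ((x / L : ℝ) : UnitAddCircle)) (volume.restrict (Set.Ico 0 L)) =
      ENNReal.ofReal L • AddCircle.haarAddCircle := by
  have h1 : Measure.map (fun x : ℝ => ((x : ℝ) : UnitAddCircle)) (volume.restrict (Set.Ioc 0 1)) =
      AddCircle.haarAddCircle := by
    have := (AddCircle.measurePreserving_mk 1 (0 : ℝ)).map_eq
    rw [zero_add, AddCircle.volume_eq_smul_haarAddCircle, ENNReal.ofReal_one, one_smul] at this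
    exact this
  have h2 : Measure.map (fun x : ℝ => L⁻¹ * x) (volume.restrict (Set.Ioc 0 L)) =
      ENNReal.ofReal L • volume.restrict (Set.Ioc 0 1) := by
    have hpre : Set.Ioc 0 L = (fun x : ℝ => L⁻¹ * x) ⁻¹' Set.Ioc 0 1 := by
      ext x
      simp only [Set.mem_Ioc, Set.mem_preimage, inv_mul_eq_div, div_le_one hL, div_pos_iff_of_pos_right hL]
    rw [hpre, ← Measure.restrict_map (by fun_prop) measurableSet_Ioc,
      Real.map_volume_mul_left (inv_ne_zero hL.ne'), inv_inv, abs_of_pos hL,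
      Measure.restrict_smul]
  have h3 : (fun x : ℝ => ((x / L : ℝ) : UnitAddCircle)) =
      (fun x : ℝ => ((x : ℝ) : UnitAddCircle)) ∘ (fun x : ℝ => L⁻¹ * x) := by
    ext x; simp [div_eq_inv_mul]
  rw [← Measure.restrict_congr_set Ioo_ae_eq_Ico, Measure.restrict_congr_set Ioo_ae_eq_Ioc, h3, ← Measure.map_map AddCircle.measurable_mk' (by fun_prop),
    h2, Measure.map_smul, h1]

lemma measurableSet_cube (d : ℕ) (L : ℝ) : MeasurableSet (cube d L) := by
  unfold cube
  simp only [Set.ofPred_forall]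
  refine MeasurableSet.iInter fun i => ?_
  have : Measurable fun x : Eu d => x i := by fun_prop
  exact this measurableSet_Ico

lemma pi_const_smul {ι α : Type*} [Fintype ι] [MeasurableSpace α] (μ : Measure α)
    [IsProbabilityMeasure μ] (c : ℝ) :
    Measure.pi (fun _ : ι => ENNReal.ofReal c • μ) =
      ENNReal.ofReal c ^ Fintype.card ι • Measure.pi fun _ : ι => μ := by
  have : SigmaFinite (ENNReal.ofReal c • μ) := by
    have := Measure.smul_finite μ (ENNReal.ofReal_ne_top (r := c))
    infer_instance
  refine Measure.pi_eq fun s _ => ?_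
  simp [Measure.pi_pi, Finset.prod_mul_distrib, Finset.prod_const]

lemma map_toTorus_restrict_cube (d : ℕ) {L : ℝ} (hL : 0 < L) :
    Measure.map (toTorus d L) (volume.restrict (cube d L)) =
      ENNReal.ofReal (L ^ d) • torusHaar d := by
  have h1 : Measure.map WithLp.ofLp (volume.restrict (cube d L)) =
      Measure.pi fun _ : Fin d => volume.restrict (Set.Ico 0 L) := by
    have hpre : cube d L = WithLp.ofLp ⁻¹' (Set.univ.pi fun _ : Fin d => Set.Ico 0 L) := by
      ext x; simp [cube]
    rw [hpre, ← Measure.restrict_map (PiLp.volume_preserving_ofLp (Fin d)).measurable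
      (MeasurableSet.univ_pi fun _ => measurableSet_Ico),
      (PiLp.volume_preserving_ofLp (Fin d)).map_eq, volume_pi, Measure.restrict_pi_pi]
  have hm : Measurable (fun x : ℝ => ((x / L : ℝ) : UnitAddCircle)) :=
    AddCircle.measurable_mk'.comp (by fun_prop)
  have h2 : toTorus d L = (fun y : Fin d → ℝ => fun i => ((y i / L : ℝ) : UnitAddCircle)) ∘
      WithLp.ofLp := rfl
  rw [h2, ← Measure.map_map (measurable_pi_lambda _ fun i => by
    simpa using! hm.comp (measurable_pi_apply i))
    (PiLp.volume_preserving_ofLp (Fin d)).measurable, h1]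
  have h3 := map_circle_restrict_Ico hL
  have : ∀ _ : Fin d, SigmaFinite (Measure.map (fun x : ℝ => ((x / L : ℝ) : UnitAddCircle))
      (volume.restrict (Set.Ico 0 L))) := fun _ => by
    rw [h3]
    have := Measure.smul_finite (AddCircle.haarAddCircle (T := (1 : ℝ)))
      (ENNReal.ofReal_ne_top (r := L))
    infer_instance
  rw [Measure.pi_map_pi (f := fun _ (x : ℝ) => ((x / L : ℝ) : UnitAddCircle))
    fun _ => hm.aemeasurable]
  simp_rw [h3]
  rw [pi_const_smul, Fintype.card_fin, ENNReal.ofReal_pow hL.le]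
  rfl

/-- Integration over `ℝ^d` by summing over the lattice translates of the cube. -/
lemma lintegral_eq_lintegral_cube_tsum (d : ℕ) {L : ℝ} (hL : 0 < L) {H : Eu d → ℝ≥0∞}
    (hH : Measurable H) :
    ∫⁻ x, H x = ∫⁻ x in cube d L, ∑' z, H (x - latPt d L z) := by
  have hH' : ∀ z, Measurable fun x => H (x - latPt d L z) := fun z =>
    hH.comp (measurable_id.sub_const (latPt d L z))
  rw [lintegral_tsum fun z => (hH' z).aemeasurable]
  have h1 : ∀ z, ∫⁻ x in cube d L, H (x - latPt d L z) =
      ∫⁻ x in (fun x => x + latPt d L z) ⁻¹' cube d L, H x := by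
    intro z
    have := (measurePreserving_add_right volume (latPt d L z)).setLIntegral_comp_preimage
      (measurableSet_cube d L) (hH' z)
    rw [← this]
    simp
  simp_rw [h1]
  rw [← lintegral_iUnion (fun z => (measurableSet_cube d L).preimage (by fun_prop))]
  · rw [← setLIntegral_univ]
    congr 2
    symm
    rw [Set.eq_univ_iff_forall]
    intro x
    rw [Set.mem_iUnion]
    refine ⟨fun i => -⌊x i / L⌋, fun i => ?_⟩
    have h2 := Int.floor_le (x i / L)
    have h3 := Int.lt_floor_add_one (x i / L)
    rw [le_div_iff₀ hL] at h2
    rw [div_lt_iff₀ hL] at h3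
    simp only [latPt, WithLp.equiv_symm_apply, PiLp.add_apply, Int.cast_neg, Set.mem_Ico]
    constructor <;> linarith
  · intro z w hzw
    rw [Function.onFun, Set.disjoint_left]
    intro x hx hy
    apply hzw
    ext i
    have h2 := hx i
    have h3 := hy i
    simp only [latPt, WithLp.equiv_symm_apply, PiLp.add_apply, Set.mem_Ico] at h2 h3
    have h4 : L * (z i : ℝ) < L * ((w i : ℝ) + 1) := by linarith
    have h5 : L * (w i : ℝ) < L * ((z i : ℝ) + 1) := by linarith
    have h6 := lt_of_mul_lt_mul_left h4 hL.le
    have h7 := lt_of_mul_lt_mul_left h5 hL.le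
    norm_cast at h6 h7
    omega

lemma mFourier_toTorus (d : ℕ) (L : ℝ) (k : Fin d → ℤ) (x : Eu d) :
    UnitAddTorus.mFourier k (toTorus d L x) =
      Complex.exp (2 * Real.pi * Complex.I * (inner ℝ x (dualPt d L k) : ℝ)) := by
  have h1 : ∀ i, (fourier (k i) ((x i / L : ℝ) : UnitAddCircle) : ℂ) =
      Complex.exp (2 * Real.pi * Complex.I * ((k i : ℝ) / L * x i : ℝ)) := by
    intro i
    rw [fourier_coe_apply]
    congr 1
    push_cast
    ring
  simp only [UnitAddTorus.mFourier, ContinuousMap.coe_mk, toTorus]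
  simp_rw [h1]
  rw [← Complex.exp_sum, ← Finset.mul_sum, ← Complex.ofReal_sum]
  congr 3

lemma integral_mFourier (d : ℕ) (k : Fin d → ℤ) :
    ∫ t, UnitAddTorus.mFourier k t ∂torusHaar d = if k = 0 then 1 else 0 := by
  split_ifs with h
  · simp [h, UnitAddTorus.mFourier_zero]
  · obtain ⟨i, hi⟩ := Function.ne_iff.mp h
    simp only [UnitAddTorus.mFourier, ContinuousMap.coe_mk, torusHaar]
    rw [integral_fintype_prod_eq_prod (fun i (t : UnitAddCircle) => (fourier (k i) t : ℂ))]
    refine Finset.prod_eq_zero (Finset.mem_univ i) ?_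
    have := (orthonormal_iff_ite.mp <| orthonormal_fourier (T := (1 : ℝ))) (0 : ℤ) (k i)
    rw [if_neg (fun h => hi h.symm)] at this
    simpa [ContinuousMap.inner_toLp] using this

/-- A finite measure on the torus is determined by its Fourier coefficients. -/
lemma measure_ext_of_integral_mFourier {d : ℕ} {μ ν : Measure (UnitAddTorus (Fin d))}
    [IsFiniteMeasure μ] [IsFiniteMeasure ν]
    (h : ∀ k, ∫ t, UnitAddTorus.mFourier k t ∂μ = ∫ t, UnitAddTorus.mFourier k t ∂ν) : μ = ν := by
  have hint : ∀ (κ : Measure (UnitAddTorus (Fin d))) [IsFiniteMeasure κ]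
      (φ : C(UnitAddTorus (Fin d), ℂ)), Integrable φ κ := fun κ _ φ =>
    φ.continuous.integrable_of_hasCompactSupport (HasCompactSupport.of_compactSpace _)
  have hcont : ∀ (κ : Measure (UnitAddTorus (Fin d))) [IsFiniteMeasure κ],
      Continuous fun φ : C(UnitAddTorus (Fin d), ℂ) => ∫ t, φ t ∂κ := by
    intro κ _
    refine (LinearMap.mkContinuous
      ({ toFun := fun φ => ∫ t, φ t ∂κ
         map_add' := fun φ χ => integral_add (hint κ φ) (hint κ χ)
         map_smul' := fun c φ => integral_smul c _ } : C(UnitAddTorus (Fin d), ℂ) →ₗ[ℂ] ℂ)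
      (κ.real Set.univ) fun φ => ?_).continuous
    rw [mul_comm]
    exact norm_integral_le_of_norm_le_const (Eventually.of_forall fun t => φ.norm_coe_le_norm t)
  have key : ∀ φ : C(UnitAddTorus (Fin d), ℂ), ∫ t, φ t ∂μ = ∫ t, φ t ∂ν := by
    have hd := (Submodule.dense_iff_topologicalClosure_eq_top).2
      (UnitAddTorus.span_mFourier_closure_eq_top (d := Fin d))
    refine fun φ => congrFun (Continuous.ext_on hd (hcont μ) (hcont ν) fun φ hφ => ?_) φ
    induction hφ using Submodule.span_induction with
    | mem x hx => obtain ⟨k, rfl⟩ := hx; exact h k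
    | zero => simp
    | add x y _ _ hx hy =>
      simp only [ContinuousMap.add_apply]
      rw [integral_add (hint μ x) (hint μ y), integral_add (hint ν x) (hint ν y), hx, hy]
    | smul c x _ hx =>
      simp only [ContinuousMap.smul_apply]
      rw [integral_smul, integral_smul, hx]
  refine ext_of_forall_integral_eq_of_IsFiniteMeasure fun φ => ?_
  have := key ⟨fun t => (φ t : ℂ), by fun_prop⟩
  simp only [ContinuousMap.coe_mk] at this
  rw [integral_complex_ofReal, integral_complex_ofReal] at this
  exact_mod_cast this

lemma norm_mFourier_apply {d : ℕ} (k : Fin d → ℤ) (t : UnitAddTorus (Fin d)) :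
    ‖UnitAddTorus.mFourier k t‖ = 1 := by
  rw [UnitAddTorus.mFourier, ContinuousMap.coe_mk, norm_prod]
  exact Finset.prod_eq_one fun i _ => Circle.norm_coe _

/-- The Fourier series on the torus with coefficients `S`. -/
def torusSeries {d : ℕ} (S : (Fin d → ℤ) → ℝ) : C(UnitAddTorus (Fin d), ℂ) :=
  ∑' k, (S k : ℂ) • UnitAddTorus.mFourier k

lemma hasSum_torusSeries {d : ℕ} {S : (Fin d → ℤ) → ℝ} (hS : Summable fun k => |S k|)
    (t : UnitAddTorus (Fin d)) :
    HasSum (fun k => (S k : ℂ) * UnitAddTorus.mFourier k t) (torusSeries S t) := by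
  have hs : Summable fun k => (S k : ℂ) • UnitAddTorus.mFourier (d := Fin d) k := by
    refine Summable.of_norm ?_
    simpa [norm_smul, UnitAddTorus.mFourier_norm] using hS
  exact hs.hasSum.map (ContinuousMap.evalCLM ℂ t) (ContinuousMap.evalCLM ℂ t).continuous

lemma integral_mFourier_mul_torusSeries {d : ℕ} {S : (Fin d → ℤ) → ℝ}
    (hS : Summable fun k => |S k|) (k : Fin d → ℤ) :
    ∫ t, UnitAddTorus.mFourier k t * torusSeries S t ∂torusHaar d = S (-k) := by
  have h1 : ∀ l : Fin d → ℤ, ∫ t, UnitAddTorus.mFourier k t *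
      ((S l : ℂ) * UnitAddTorus.mFourier l t) ∂torusHaar d = if l = -k then (S l : ℂ) else 0 := by
    intro l
    have : ∀ t : UnitAddTorus (Fin d), UnitAddTorus.mFourier k t *
      ((S l : ℂ) * UnitAddTorus.mFourier l t) = S l * UnitAddTorus.mFourier (k + l) t := by
      intro t; rw [UnitAddTorus.mFourier_add]; ring
    simp_rw [this]
    rw [integral_const_mul, integral_mFourier]
    simp only [add_comm k l, add_eq_zero_iff_eq_neg, mul_ite, mul_one, mul_zero]
  have h2 := hasSum_integral_of_summable_integral_norm (μ := torusHaar d)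
    (F := fun (l : Fin d → ℤ) t => UnitAddTorus.mFourier k t *
      ((S l : ℂ) * UnitAddTorus.mFourier l t)) ?_ ?_
  · simp_rw [h1, tsum_mul_left, (hasSum_torusSeries hS _).tsum_eq] at h2
    rw [← h2.tsum_eq, tsum_ite_eq]
  · intro l
    refine Continuous.integrable_of_hasCompactSupport ?_ (HasCompactSupport.of_compactSpace _)
    fun_prop
  · refine hS.of_nonneg_of_le (fun l => integral_nonneg fun t => norm_nonneg _) fun l => ?_
    simp [norm_mFourier_apply]

lemma torusSeries_im {d : ℕ} {S : (Fin d → ℤ) → ℝ} (hS : Summable fun k => |S k|)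
    (heven : ∀ k, S (-k) = S k) (t : UnitAddTorus (Fin d)) : (torusSeries S t).im = 0 := by
  rw [← Complex.conj_eq_iff_im]
  have h1 := Complex.hasSum_conj'.2 (hasSum_torusSeries hS t)
  have h2 := (Equiv.neg (Fin d → ℤ)).hasSum_iff.2 (hasSum_torusSeries hS t)
  refine h1.unique (h2.congr_fun ?_)
  intro k
  simp [UnitAddTorus.mFourier_neg, heven]

lemma fper_sub_latPt (d : ℕ) (f : Eu d → ℝ) (L : ℝ) (x : Eu d) (z : Fin d → ℤ) :
    fper d f L (x - latPt d L z) = fper d f L x := by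
  unfold fper
  rw [← (Equiv.addLeft z).tsum_eq fun w => ENNReal.ofReal (f (x - latPt d L w))]
  refine tsum_congr fun w => ?_
  congr 2
  rw [sub_sub]
  congr 1
  ext i
  simp [latPt, mul_add]

/-- The periodization as a function on the torus. -/
lemma exists_fper_eq_comp_toTorus (d : ℕ) {f : Eu d → ℝ} {L : ℝ} (hL : L ≠ 0)
    (hper : Continuous (fper d f L)) :
    ∃ P : UnitAddTorus (Fin d) → ℝ≥0∞, Continuous P ∧ ∀ x, P (toTorus d L x) = fper d f L x := by
  have hq := isOpenQuotientMap_toTorus d hL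
  have h : ∀ x, fper d f L (Function.surjInv hq.surjective (toTorus d L x)) = fper d f L x := by
    intro x
    obtain ⟨z, hz⟩ := exists_latPt_of_toTorus_eq d hL
      (Function.surjInv_eq hq.surjective (toTorus d L x))
    rw [hz, fper_sub_latPt]
  refine ⟨fun t => fper d f L (Function.surjInv hq.surjective t), ?_, h⟩
  rw [hq.continuous_comp_iff.symm]
  exact hper.congr fun x => (h x).symm

/-- Pushing the density `f` forward to the torus produces its periodization. -/
lemma map_toTorus_withDensity (d : ℕ) {f : Eu d → ℝ} (hf : Continuous f) {L : ℝ} (hL : 0 < L)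
    {P : UnitAddTorus (Fin d) → ℝ≥0∞} (hP : Continuous P)
    (hPf : ∀ x, P (toTorus d L x) = fper d f L x) :
    Measure.map (toTorus d L) (volume.withDensity fun x => ENNReal.ofReal (f x)) =
      (torusHaar d).withDensity fun t => ENNReal.ofReal (L ^ d) * P t := by
  have hψ := (continuous_toTorus d L).measurable
  have hfm : Measurable fun x => ENNReal.ofReal (f x) := by fun_prop
  refine Measure.ext_of_lintegral _ fun φ hφ => ?_
  rw [lintegral_map hφ hψ, show ∫⁻ x, φ (toTorus d L x) ∂(volume.withDensity fun x => ENNReal.ofReal (f x)) =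
      ∫⁻ x, ((fun x => ENNReal.ofReal (f x)) * fun x => φ (toTorus d L x)) x from
      lintegral_withDensity_eq_lintegral_mul _ hfm (hφ.comp hψ),
    lintegral_eq_lintegral_cube_tsum d hL (H := (fun x => ENNReal.ofReal (f x)) *
      fun x => φ (toTorus d L x)) (hfm.mul (hφ.comp hψ)),
    lintegral_withDensity_eq_lintegral_mul _ (by fun_prop) hφ]
  have h1 : ∀ x, ∑' z, ((fun x => ENNReal.ofReal (f x)) * fun x => φ (toTorus d L x))
      (x - latPt d L z) = P (toTorus d L x) * φ (toTorus d L x) := by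
    intro x
    simp only [Pi.mul_apply, toTorus_sub_latPt d hL.ne']
    rw [ENNReal.tsum_mul_right, hPf]
    rfl
  have h2 := lintegral_map (μ := volume.restrict (cube d L)) (hP.measurable.mul hφ) hψ
  rw [map_toTorus_restrict_cube d hL, lintegral_smul_measure, smul_eq_mul] at h2
  simp only [Pi.mul_apply] at h2
  rw [lintegral_congr h1, ← h2, ← lintegral_const_mul _ (by fun_prop)]
  simp only [Pi.mul_apply, mul_assoc]

/-- Poisson summation: the periodization is given by its Fourier series. -/
lemma fper_eq_torusSeries (d : ℕ) {f g : Eu d → ℝ} (hf : Continuous f) (hf0 : ∀ x, 0 ≤ f x)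
    (hfi : Integrable f) (hFT : ∀ k, 𝓕 (fun x => (f x : ℂ)) k = (g k : ℂ)) {L : ℝ} (hL : 0 < L)
    (hS : Summable fun z => |g (dualPt d L z)|) (hper : Continuous (fper d f L)) :
    ∃ q : UnitAddTorus (Fin d) → ℝ, Continuous q ∧ (∀ t, 0 ≤ q t) ∧
      (∀ t, (q t : ℂ) = torusSeries (fun z => g (dualPt d L z)) t) ∧
      ∀ x, fper d f L x = ENNReal.ofReal ((L ^ d)⁻¹ * q (toTorus d L x)) := by
  set S : (Fin d → ℤ) → ℝ := fun z => g (dualPt d L z) with hSdef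
  obtain ⟨P, hP, hPf⟩ := exists_fper_eq_comp_toTorus d hL.ne' hper
  have hV : 0 < L ^ d := pow_pos hL d
  have hdual : ∀ z, dualPt d L (-z) = -dualPt d L z := by
    intro z; ext i; simp [dualPt, neg_div]
  have hgeven : ∀ k, g (-k) = g k := by
    intro k
    have h : (starRingEnd ℂ) (𝓕 (fun x => (f x : ℂ)) k) = 𝓕 (fun x => (f x : ℂ)) (-k) := by
      rw [Real.fourier_eq', Real.fourier_eq', ← integral_conj]
      refine integral_congr_ae (Eventually.of_forall fun x => ?_)
      simp [← Complex.exp_conj, Complex.conj_ofNat]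
    rw [hFT, hFT, Complex.conj_ofReal] at h
    exact_mod_cast h.symm
  have heven : ∀ z, S (-z) = S z := fun z => by simp only [hSdef]; rw [hdual, hgeven]
  set G := torusSeries S with hG
  have him : ∀ t, G t = ((G t).re : ℂ) := fun t =>
    Complex.ext rfl (by rw [torusSeries_im hS heven]; simp)
  have hre : Continuous fun t => (G t).re := by fun_prop
  set μ := Measure.map (toTorus d L) (volume.withDensity fun x => ENNReal.ofReal (f x)) with hμ
  have hμf : IsFiniteMeasure μ := by
    have := isFiniteMeasure_withDensity_ofReal hfi.2
    rw [hμ]; infer_instance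
  have hint : ∀ φ : UnitAddTorus (Fin d) → ℂ, Continuous φ →
      ∀ (κ : Measure (UnitAddTorus (Fin d))) [IsFiniteMeasure κ], Integrable φ κ := fun φ hφ κ _ =>
    hφ.integrable_of_hasCompactSupport (HasCompactSupport.of_compactSpace _)
  have hintR : ∀ φ : UnitAddTorus (Fin d) → ℝ, Continuous φ → Integrable φ (torusHaar d) :=
    fun φ hφ => hφ.integrable_of_hasCompactSupport (HasCompactSupport.of_compactSpace _)
  have hfin1 := isFiniteMeasure_withDensity_ofReal (hintR _ hre).2
  have hfin2 := isFiniteMeasure_withDensity_ofReal (hintR _ hre.neg).2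
  have hcoef : ∀ k, ∫ t, UnitAddTorus.mFourier k t ∂μ = S (-k) := by
    intro k
    rw [hμ, integral_map (continuous_toTorus d L).aemeasurable
      (UnitAddTorus.mFourier k).continuous.aestronglyMeasurable,
      integral_withDensity_eq_integral_toReal_smul (by fun_prop)
        (Eventually.of_forall fun _ => ENNReal.ofReal_lt_top)]
    simp only [hSdef]
    rw [hdual, ← hFT, Real.fourier_eq']
    refine integral_congr_ae (Eventually.of_forall fun x => ?_)
    simp only [mFourier_toTorus, ENNReal.toReal_ofReal (hf0 x), Complex.real_smul, smul_eq_mul,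
      inner_neg_right]
    rw [mul_comm]
    congr 2
    push_cast
    ring
  have hadd : μ + (torusHaar d).withDensity (fun t => ENNReal.ofReal (-(G t).re)) =
      (torusHaar d).withDensity (fun t => ENNReal.ofReal (G t).re) := by
    refine measure_ext_of_integral_mFourier fun k => ?_
    have hk := (UnitAddTorus.mFourier k).continuous
    rw [integral_add_measure (hint _ hk _) (hint _ hk _), hcoef,
      ← integral_mFourier_mul_torusSeries hS,
      integral_withDensity_eq_integral_toReal_smul (by fun_prop)
        (Eventually.of_forall fun _ => ENNReal.ofReal_lt_top),
      integral_withDensity_eq_integral_toReal_smul (by fun_prop)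
        (Eventually.of_forall fun _ => ENNReal.ofReal_lt_top), ← integral_add]
    · refine integral_congr_ae (Eventually.of_forall fun t => ?_)
      simp only [ENNReal.toReal_ofReal', Complex.real_smul]
      rw [← hG, him t, Complex.ofReal_re]
      have : max (G t).re 0 = (G t).re + max (-(G t).re) 0 := by
        rcases le_total 0 (G t).re with h | h
        · rw [max_eq_left h, max_eq_right (by linarith)]; ring
        · rw [max_eq_right h, max_eq_left (by linarith)]; ring
      rw [this]
      push_cast
      ring
    · exact hint _ (by fun_prop) _
    · refine hint _ ?_ _
      simp only [ENNReal.toReal_ofReal']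
      fun_prop
  have hfinre : ∫⁻ t, ENNReal.ofReal (G t).re ∂torusHaar d ≠ ∞ := by
    simpa using measure_ne_top ((torusHaar d).withDensity fun t => ENNReal.ofReal (G t).re) Set.univ
  rw [hμ, map_toTorus_withDensity d hf hL hP hPf, ← withDensity_add_left (by fun_prop),
    eq_comm, withDensity_eq_iff (by fun_prop) (by fun_prop)
      hfinre] at hadd
  · have heq := (Continuous.ae_eq_iff_eq (torusHaar d) (ENNReal.continuous_ofReal.comp hre)
      (((ENNReal.continuous_const_mul ENNReal.ofReal_ne_top).comp hP).add
        (ENNReal.continuous_ofReal.comp hre.neg))).1 hadd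
    have hq : ∀ t, 0 ≤ (G t).re ∧ P t = ENNReal.ofReal ((L ^ d)⁻¹ * (G t).re) := by
      intro t
      have h1 : ENNReal.ofReal (L ^ d) * P t + ENNReal.ofReal (-(G t).re) =
        ENNReal.ofReal (G t).re := (congrFun heq t).symm
      have h0 : 0 ≤ (G t).re := by
        by_contra! hneg
        rw [ENNReal.ofReal_of_nonpos hneg.le, add_eq_zero, ENNReal.ofReal_eq_zero] at h1
        linarith [h1.2]
      refine ⟨h0, ?_⟩
      rw [ENNReal.ofReal_of_nonpos (by linarith : -(G t).re ≤ 0), add_zero] at h1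
      rw [ENNReal.ofReal_mul (by positivity), ← h1, ← mul_assoc,
        ← ENNReal.ofReal_mul (by positivity), inv_mul_cancel₀ hV.ne', ENNReal.ofReal_one, one_mul]
    exact ⟨fun t => (G t).re, hre, fun t => (hq t).1, fun t => (him t).symm, fun x => by
      rw [← hPf, (hq _).2]⟩

lemma hasSum_prod_pi_fin {κ 𝕜 : Type*} [NormedField 𝕜] [CompleteSpace 𝕜] (n : ℕ)
    (a : Fin n → κ → 𝕜)
    (ha : ∀ i, Summable fun j => ‖a i j‖) :
    Summable (fun k : Fin n → κ => ‖∏ i, a i (k i)‖) ∧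
      HasSum (fun k : Fin n → κ => ∏ i, a i (k i)) (∏ i, ∑' j, a i j) := by
  induction n with
  | zero =>
    refine ⟨(hasSum_fintype _).summable, ?_⟩
    simp
  | succ n ih =>
    obtain ⟨h1, h2⟩ := ih (fun i => a i.succ) fun i => ha i.succ
    let e : κ × (Fin n → κ) ≃ (Fin (n + 1) → κ) := Fin.consEquiv fun _ => κ
    have he : ∀ p, ∏ i, a i (e p i) = a 0 p.1 * ∏ i : Fin n, a i.succ (p.2 i) := by
      intro p
      rw [Fin.prod_univ_succ]
      congr 1
    have hs := (ha 0).mul_norm h1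
    rw [← e.summable_iff, ← e.hasSum_iff]
    refine ⟨hs.congr fun p => ?_, ?_⟩
    · rw [Function.comp_apply, he]
    · rw [Fin.prod_univ_succ, ← h2.tsum_eq, tsum_mul_tsum_of_summable_norm (ha 0) h1]
      have : (fun k : Fin (n + 1) → κ => ∏ i, a i (k i)) ∘ e =
          fun p => a 0 p.1 * ∏ i : Fin n, a i.succ (p.2 i) := funext he
      rw [this]
      exact hs.of_norm.hasSum

/-- A finite product of absolutely convergent series, as a series over the product index set. -/
lemma hasSum_prod_pi {κ 𝕜 : Type*} [NormedField 𝕜] [CompleteSpace 𝕜] (ι : Type*) [Fintype ι]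
    (a : ι → κ → 𝕜)
    (ha : ∀ i, Summable fun j => ‖a i j‖) :
    Summable (fun k : ι → κ => ‖∏ i, a i (k i)‖) ∧
      HasSum (fun k : ι → κ => ∏ i, a i (k i)) (∏ i, ∑' j, a i j) := by
  let e := Fintype.equivFin ι
  let E : (Fin (Fintype.card ι) → κ) ≃ (ι → κ) := Equiv.arrowCongr e.symm (Equiv.refl κ)
  obtain ⟨h1, h2⟩ := hasSum_prod_pi_fin _ (fun i => a (e.symm i)) fun i => ha _
  have hprod : ∀ k, ∏ i, a i (E k i) = ∏ i, a (e.symm i) (k i) := by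
    intro k
    rw [← e.symm.prod_comp]
    exact Finset.prod_congr rfl fun i _ => by
      simp only [E, Equiv.arrowCongr_apply, Function.comp_apply, Equiv.symm_symm,
        Equiv.apply_symm_apply, Equiv.refl_apply]
  rw [← E.summable_iff, ← E.hasSum_iff]
  have hE : (fun k : ι → κ => ∏ i, a i (k i)) ∘ E = fun k => ∏ i, a (e.symm i) (k i) := funext hprod
  refine ⟨h1.congr fun k => ?_, ?_⟩
  · rw [Function.comp_apply, hprod]
  · rw [e.symm.prod_comp (fun i => ∑' j, a i j)] at h2
    rw [hE]
    exact h2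

open Classical in
/-- The number of elements of a cycle. -/
def cycleCard {N : ℕ} (π : Equiv.Perm (Fin N)) (q : Quotient (Equiv.Perm.SameCycle.setoid π)) : ℕ :=
  (Finset.univ.filter fun i : Fin N => (⟦i⟧ : Quotient (Equiv.Perm.SameCycle.setoid π)) = q).card

lemma cycleCard_ne_one_iff {N : ℕ} (π : Equiv.Perm (Fin N)) (i : Fin N) :
    cycleCard π ⟦i⟧ ≠ 1 ↔ i ∈ π.support := by
  classical
  unfold cycleCard
  rw [Equiv.Perm.mem_support, not_iff_not, Finset.card_eq_one]
  simp only [Quotient.eq]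
  constructor
  · rintro ⟨a, ha⟩
    have h1 : i ∈ ({a} : Finset (Fin N)) := by
      rw [← ha, Finset.mem_filter]
      exact ⟨Finset.mem_univ _, Equiv.Perm.SameCycle.refl _ _⟩
    have h2 : π i ∈ ({a} : Finset (Fin N)) := by
      rw [← ha, Finset.mem_filter]
      exact ⟨Finset.mem_univ _, Equiv.Perm.sameCycle_apply_left.2 (Equiv.Perm.SameCycle.refl _ _)⟩
    rw [Finset.mem_singleton] at h1 h2
    rw [h2, ← h1]
  · intro h
    refine ⟨i, ?_⟩
    ext j
    rw [Finset.mem_filter, Finset.mem_singleton]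
    refine ⟨fun hj => ?_, fun hj => ⟨Finset.mem_univ _, hj ▸ Equiv.Perm.SameCycle.refl _ _⟩⟩
    exact (Equiv.Perm.SameCycle.eq_of_right hj.2 h)

lemma cycleCard_eq_card_support {N : ℕ} (π : Equiv.Perm (Fin N)) {i : Fin N} (hi : i ∈ π.support) :
    cycleCard π ⟦i⟧ = (π.cycleOf i).support.card := by
  classical
  unfold cycleCard
  congr 1
  ext j
  rw [Finset.mem_filter, Equiv.Perm.mem_support_cycleOf_iff, Quotient.eq]
  exact ⟨fun h => ⟨h.2.symm, hi⟩, fun h => ⟨Finset.mem_univ _, h.1.symm⟩⟩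

open Classical in
lemma prod_cycleCard_ne_one {M : Type*} [CommMonoid M] {N : ℕ} (π : Equiv.Perm (Fin N))
    (θ : ℕ → M) :
    ∏ q with cycleCard π q ≠ 1, θ (cycleCard π q) = (π.cycleType.map θ).prod := by
  rw [Equiv.Perm.cycleType_def, Multiset.map_map]
  change _ = ∏ c ∈ π.cycleFactorsFinset, θ (c.support.card)
  have hout : ∀ q : Quotient (Equiv.Perm.SameCycle.setoid π), cycleCard π q ≠ 1 →
      q.out ∈ π.support := fun q hq => by
    rw [← cycleCard_ne_one_iff, Quotient.out_eq]; exact hq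
  refine Finset.prod_bij (fun q _ => π.cycleOf q.out) ?_ ?_ ?_ ?_
  · intro q hq
    exact Equiv.Perm.cycleOf_mem_cycleFactorsFinset_iff.2 (hout q (Finset.mem_filter.1 hq).2)
  · intro q hq r hr h
    rw [← Quotient.out_eq q, ← Quotient.out_eq r, Quotient.eq]
    have h1 : r.out ∈ (π.cycleOf q.out).support := by
      rw [h, Equiv.Perm.mem_support_cycleOf_iff]
      exact ⟨Equiv.Perm.SameCycle.refl _ _, hout r (Finset.mem_filter.1 hr).2⟩
    exact (Equiv.Perm.mem_support_cycleOf_iff.1 h1).1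
  · intro c hc
    obtain ⟨i, hi⟩ := (Equiv.Perm.mem_cycleFactorsFinset_iff.1 hc).1.nonempty_support
    have hci := Equiv.Perm.cycle_is_cycleOf hi hc
    have his : i ∈ π.support := Equiv.Perm.mem_cycleFactorsFinset_support_le hc hi
    refine ⟨⟦i⟧, Finset.mem_filter.2 ⟨Finset.mem_univ _, (cycleCard_ne_one_iff π i).2 his⟩, ?_⟩
    rw [hci]
    have h1 : Equiv.Perm.SameCycle π (⟦i⟧ : Quotient (Equiv.Perm.SameCycle.setoid π)).out i :=
      Quotient.exact (s := Equiv.Perm.SameCycle.setoid π) (Quotient.out_eq _)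
    exact h1.cycleOf_eq
  · intro q hq
    rw [← cycleCard_eq_card_support π (hout q (Finset.mem_filter.1 hq).2), Quotient.out_eq]

open Classical in
lemma sum_cycleCard {N : ℕ} (π : Equiv.Perm (Fin N)) : ∑ q, cycleCard π q = N := by
  have := Finset.card_eq_sum_card_fiberwise (s := (Finset.univ : Finset (Fin N)))
    (t := Finset.univ) (f := fun i => (⟦i⟧ : Quotient (Equiv.Perm.SameCycle.setoid π)))
    fun _ _ => Finset.mem_coe.2 (Finset.mem_univ _)
  rw [Finset.card_univ, Fintype.card_fin] at this
  exact this.symm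

open Classical in
lemma prod_cycleCard {M : Type*} [CommMonoid M] {N : ℕ} (π : Equiv.Perm (Fin N)) (θ : ℕ → M) :
    ∏ q, θ (cycleCard π q) = ((cycParts π).map θ).prod := by
  rw [← Finset.prod_filter_mul_prod_filter_not Finset.univ (fun q => cycleCard π q ≠ 1),
    prod_cycleCard_ne_one, cycParts, Multiset.map_add, Multiset.prod_add]
  congr 1
  rw [Finset.prod_congr rfl (g := fun _ => θ 1) fun q hq => by
    rw [not_not.1 (Finset.mem_filter.1 hq).2], Finset.prod_const, Multiset.map_replicate,
    Multiset.prod_replicate]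
  congr 1
  have h1 := sum_cycleCard π
  rw [← Finset.sum_filter_add_sum_filter_not Finset.univ (fun q => cycleCard π q ≠ 1),
    Finset.sum_congr rfl (s₁ := Finset.univ.filter fun q => ¬ cycleCard π q ≠ 1) (g := fun _ => 1)
      fun q hq => not_not.1 (Finset.mem_filter.1 hq).2, Finset.sum_const] at h1
  have h2 := prod_cycleCard_ne_one π (fun j => Multiplicative.ofAdd j)
  have h3 : ∑ q with cycleCard π q ≠ 1, cycleCard π q = π.cycleType.sum := by
    have := congrArg Multiplicative.toAdd h2
    rw [toAdd_prod] at this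
    simp only [toAdd_ofAdd] at this
    rw [this]
    induction π.cycleType using Multiset.induction_on with
    | empty => simp
    | cons a s ih => simp [ih]
  rw [h3] at h1
  simp only [smul_eq_mul, mul_one] at h1
  omega

open Classical in
/-- Summing a product weight over all labellings that are constant on cycles. -/
lemma tsum_cycle_invariant {κ : Type*} {N : ℕ} (π : Equiv.Perm (Fin N)) {S : κ → ℝ}
    (hS0 : ∀ k, 0 ≤ S k) (hS1 : ∀ k, S k ≤ 1) (hS : Summable S) :
    ∑' k : Fin N → κ, (if ∀ i, k (π i) = k i then ∏ i, S (k i) else 0) =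
      ((cycParts π).map fun j => ∑' k, S k ^ j).prod := by
  set Q := Quotient (Equiv.Perm.SameCycle.setoid π)
  have hinj : Function.Injective fun (k : Q → κ) (i : Fin N) => k ⟦i⟧ := by
    intro k l h
    funext q
    rw [← Quotient.out_eq q]
    exact congrFun h q.out
  rw [← hinj.tsum_eq, ← prod_cycleCard]
  · have hpos : ∀ q : Q, cycleCard π q ≠ 0 := by
      intro q
      unfold cycleCard
      rw [Finset.card_ne_zero]
      exact ⟨q.out, Finset.mem_filter.2 ⟨Finset.mem_univ _, Quotient.out_eq q⟩⟩
    rw [← (hasSum_prod_pi Q (fun q k => S k ^ cycleCard π q) fun q => ?_).2.tsum_eq]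
    · refine tsum_congr fun k => ?_
      rw [if_pos]
      · rw [← Finset.prod_fiberwise Finset.univ (fun i => (⟦i⟧ : Q))]
        refine Finset.prod_congr rfl fun q _ => ?_
        rw [cycleCard, ← Finset.prod_const]
        exact Finset.prod_congr rfl fun i hi => congrArg (fun r => S (k r)) (Finset.mem_filter.1 hi).2
      · intro i
        refine congrArg k (Quotient.sound ?_)
        exact Equiv.Perm.sameCycle_apply_left.2 (Equiv.Perm.SameCycle.refl π i)
    · refine hS.of_nonneg_of_le (fun k => norm_nonneg _) fun k => ?_
      rw [Real.norm_eq_abs, abs_of_nonneg (pow_nonneg (hS0 k) _)]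
      exact pow_le_of_le_one (hS0 k) (hS1 k) (hpos q)
  · intro k hk
    rw [Function.mem_support] at hk
    have hk' : ∀ i, k (π i) = k i := by
      by_contra h
      exact hk (if_neg h)
    have hsc : ∀ i j, Equiv.Perm.SameCycle π i j → k i = k j := by
      intro i j hij
      obtain ⟨n, rfl⟩ := hij.exists_nat_pow_eq
      induction n with
      | zero => rfl
      | succ n ih =>
        rw [pow_succ', Equiv.Perm.mul_apply, hk']
        exact ih ⟨n, by simp⟩
    exact ⟨fun q => Quotient.lift k hsc q, rfl⟩

lemma mFourier_sub_apply {d : ℕ} (k : Fin d → ℤ) (s t : UnitAddTorus (Fin d)) :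
    UnitAddTorus.mFourier k (s - t) =
      UnitAddTorus.mFourier k s * UnitAddTorus.mFourier (-k) t := by
  simp only [UnitAddTorus.mFourier, ContinuousMap.coe_mk, ← Finset.prod_mul_distrib]
  refine Finset.prod_congr rfl fun i _ => ?_
  rw [fourier_apply, fourier_apply, fourier_apply, ← Circle.coe_mul, ← AddCircle.toCircle_add]
  congr 2
  simp [sub_eq_add_neg]

open Classical in
lemma integral_prod_mFourier {d N : ℕ} (π : Equiv.Perm (Fin N)) (k : Fin N → Fin d → ℤ) :
    ∫ t : Fin N → UnitAddTorus (Fin d), ∏ i, UnitAddTorus.mFourier (k i) (t i - t (π i))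
      ∂(Measure.pi fun _ => torusHaar d) = if ∀ i, k (π i) = k i then 1 else 0 := by
  have h1 : ∀ t : Fin N → UnitAddTorus (Fin d),
      ∏ i, UnitAddTorus.mFourier (k i) (t i - t (π i)) =
        ∏ i, UnitAddTorus.mFourier (k i + -k (π.symm i)) (t i) := by
    intro t
    simp_rw [mFourier_sub_apply, UnitAddTorus.mFourier_add, Finset.prod_mul_distrib]
    congr 1
    rw [← Equiv.prod_comp π (fun i => UnitAddTorus.mFourier (-k (π.symm i)) (t i))]
    simp
  simp_rw [h1]
  rw [integral_fintype_prod_eq_prod (f := fun i s => UnitAddTorus.mFourier (k i + -k (π.symm i)) s)]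
  simp_rw [integral_mFourier]
  rw [Finset.prod_ite_zero]
  simp only [Finset.prod_const_one, Finset.mem_univ, forall_true_left]
  refine if_congr ?_ rfl rfl
  constructor
  · intro h i
    have := h (π i)
    rwa [Equiv.symm_apply_apply, add_neg_eq_zero] at this
  · intro h i
    have := h (π.symm i)
    rw [Equiv.apply_symm_apply] at this
    rw [this, add_neg_cancel]

/-- The cyclic torus integral of a Fourier series with coefficients `S` factorizes over cycles. -/
lemma integral_prod_torusSeries {d N : ℕ} (π : Equiv.Perm (Fin N)) {S : (Fin d → ℤ) → ℝ}
    (hS0 : ∀ k, 0 ≤ S k) (hS1 : ∀ k, S k ≤ 1) (hS : Summable S) :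
    ∫ t : Fin N → UnitAddTorus (Fin d), ∏ i, torusSeries S (t i - t (π i))
      ∂(Measure.pi fun _ => torusHaar d) =
        ((((cycParts π).map fun j => ∑' k, S k ^ j).prod : ℝ) : ℂ) := by
  classical
  have hSa : Summable fun k => |S k| := hS.abs
  obtain ⟨hp1, -⟩ := hasSum_prod_pi (Fin N) (fun _ => S) fun _ => hSa
  have hexp : ∀ t : Fin N → UnitAddTorus (Fin d), ∏ i, torusSeries S (t i - t (π i)) =
      ∑' k : Fin N → Fin d → ℤ, ((∏ i, S (k i) : ℝ) : ℂ) *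
        ∏ i, UnitAddTorus.mFourier (k i) (t i - t (π i)) := by
    intro t
    simp_rw [← fun i => (hasSum_torusSeries hSa (t i - t (π i))).tsum_eq]
    rw [← (hasSum_prod_pi (Fin N)
      (fun i k => (S k : ℂ) * UnitAddTorus.mFourier k (t i - t (π i))) fun i => ?_).2.tsum_eq]
    · refine tsum_congr fun k => ?_
      rw [Finset.prod_mul_distrib, Complex.ofReal_prod]
    · simpa [norm_mFourier_apply] using hSa
  have hnorm : ∀ (k : Fin N → Fin d → ℤ) (t : Fin N → UnitAddTorus (Fin d)),
      ‖((∏ i, S (k i) : ℝ) : ℂ) * ∏ i, UnitAddTorus.mFourier (k i) (t i - t (π i))‖ =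
        ‖∏ i, S (k i)‖ := by
    intro k t
    rw [norm_mul, Complex.norm_real, norm_prod (f := fun i =>
      UnitAddTorus.mFourier (k i) (t i - t (π i)))]
    simp [norm_mFourier_apply]
  have hsum := hasSum_integral_of_summable_integral_norm (μ := Measure.pi fun _ => torusHaar d)
    (F := fun (k : Fin N → Fin d → ℤ) (t : Fin N → UnitAddTorus (Fin d)) =>
      ((∏ i, S (k i) : ℝ) : ℂ) * ∏ i, UnitAddTorus.mFourier (k i) (t i - t (π i)))
    (fun k => Continuous.integrable_of_hasCompactSupport (by fun_prop)
      (HasCompactSupport.of_compactSpace _)) (by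
        simp_rw [hnorm]
        simpa using hp1)
  simp_rw [hexp]
  rw [← hsum.tsum_eq]
  simp_rw [integral_const_mul, integral_prod_mFourier]
  rw [← tsum_cycle_invariant π hS0 hS1 hS, Complex.ofReal_tsum]
  refine tsum_congr fun k => ?_
  split_ifs <;> simp

/-- The spatial integral of a permutation factorizes over its cycles. -/
lemma lintegral_prod_fper (d : ℕ) {f g : Eu d → ℝ} (hf : Continuous f) (hf0 : ∀ x, 0 ≤ f x)
    (hfi : Integrable f) (hFT : ∀ k, 𝓕 (fun x => (f x : ℂ)) k = (g k : ℂ))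
    (hg0 : ∀ k, 0 ≤ g k) (hg1 : ∀ k, g k ≤ 1) {L : ℝ} (hL : 0 < L)
    (hS : Summable fun z => g (dualPt d L z)) (hper : Continuous (fper d f L)) {N : ℕ}
    (π : Equiv.Perm (Fin N)) :
    ∫⁻ x in Set.univ.pi (fun _ : Fin N => cube d L), ∏ i, fper d f L (x i - x (π i)) =
      ENNReal.ofReal ((cycParts π).map fun j => ∑' z, g (dualPt d L z) ^ j).prod := by
  obtain ⟨q, hqc, hq0, hqG, hfq⟩ := fper_eq_torusSeries d hf hf0 hfi hFT hL hS.abs hper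
  have hV : 0 < L ^ d := pow_pos hL d
  set Ψ : (Fin N → Eu d) → (Fin N → UnitAddTorus (Fin d)) := fun x i => toTorus d L (x i)
  have hΨ : Measurable Ψ := measurable_pi_lambda _ fun i =>
    (continuous_toTorus d L).measurable.comp (measurable_pi_apply i)
  have hmap : Measure.map Ψ (volume.restrict (Set.univ.pi fun _ : Fin N => cube d L)) =
      ENNReal.ofReal (L ^ d) ^ N • Measure.pi fun _ => torusHaar d := by
    rw [volume_pi, Measure.restrict_pi_pi]
    have hm := map_toTorus_restrict_cube d hL
    have : ∀ _ : Fin N, SigmaFinite (Measure.map (toTorus d L) (volume.restrict (cube d L))) :=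
      fun _ => by
        rw [hm]
        have := Measure.smul_finite (torusHaar d) (ENNReal.ofReal_ne_top (r := L ^ d))
        infer_instance
    rw [Measure.pi_map_pi (Y := fun _ => UnitAddTorus (Fin d)) (f := fun _ => toTorus d L) (hμ := this)
      fun _ => (continuous_toTorus d L).measurable.aemeasurable]
    simp_rw [hm]
    rw [pi_const_smul, Fintype.card_fin]
  set H : (Fin N → UnitAddTorus (Fin d)) → ℝ := fun t => ∏ i, q (t i - t (π i)) with hH
  have hHc : Continuous H := by fun_prop
  have h1 : ∀ x : Fin N → Eu d, ∏ i, fper d f L (x i - x (π i)) =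
      ENNReal.ofReal ((L ^ d)⁻¹ ^ N * H (Ψ x)) := by
    intro x
    simp_rw [hfq, toTorus_sub]
    rw [← ENNReal.ofReal_prod_of_nonneg fun i _ => mul_nonneg (by positivity) (hq0 _),
      Finset.prod_mul_distrib, Finset.prod_const, Finset.card_univ, Fintype.card_fin]
  simp_rw [h1]
  rw [← lintegral_map (f := fun t => ENNReal.ofReal ((L ^ d)⁻¹ ^ N * H t)) (by fun_prop) hΨ, hmap,
    lintegral_smul_measure, ← ofReal_integral_eq_lintegral_ofReal, smul_eq_mul,
    ← ENNReal.ofReal_pow hV.le, ← ENNReal.ofReal_mul (by positivity), integral_const_mul,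
    ← mul_assoc, ← mul_pow, mul_inv_cancel₀ hV.ne', one_pow, one_mul]
  · congr 1
    have h2 := integral_prod_torusSeries (d := d) π (fun z => hg0 (dualPt d L z))
      (fun z => hg1 _) hS
    simp_rw [← hqG] at h2
    rw [← Complex.ofReal_inj, ← h2, ← integral_complex_ofReal]
    simp [hH]
  · exact Continuous.integrable_of_hasCompactSupport (by fun_prop)
      (HasCompactSupport.of_compactSpace _)
  · exact Eventually.of_forall fun t => mul_nonneg (by positivity)
      (Finset.prod_nonneg fun i _ => hq0 _)

/-- The cycle weights of the annealed model. -/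
def annealedWeight (d : ℕ) (g : Eu d → ℝ) (α : ℕ → ℝ) (L : ℝ) (j : ℕ) : ℝ :=
  if j = 0 then 1 else Real.exp (-α j) * ∑' z, g (dualPt d L z) ^ j

lemma toReal_gibbsW (d : ℕ) {f g : Eu d → ℝ} (α : ℕ → ℝ) (hf : Continuous f) (hf0 : ∀ x, 0 ≤ f x)
    (hfi : Integrable f) (hFT : ∀ k, 𝓕 (fun x => (f x : ℂ)) k = (g k : ℂ))
    (hg0 : ∀ k, 0 ≤ g k) (hg1 : ∀ k, g k ≤ 1) {L : ℝ} (hL : 0 < L)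
    (hS : Summable fun z => g (dualPt d L z)) (hper : Continuous (fper d f L)) {N : ℕ}
    (π : Equiv.Perm (Fin N)) :
    (gibbsW d f α L N π).toReal = cycWeight (annealedWeight d g α L) π := by
  rw [gibbsW, lintegral_prod_fper d hf hf0 hfi hFT hg0 hg1 hL hS hper, ENNReal.toReal_mul,
    ENNReal.toReal_ofReal (Real.exp_pos _).le (r := permWeight α π), ENNReal.toReal_ofReal, ← prod_pow_cycCount,
    permWeight, ← Finset.sum_neg_distrib, Real.exp_sum, ← Finset.prod_mul_distrib, cycWeight]
  · refine Finset.prod_congr rfl fun j hj => ?_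
    have hj0 : j ≠ 0 := by have := (Finset.mem_Icc.1 hj).1; omega
    rw [annealedWeight, if_neg hj0, mul_pow, ← Real.exp_nat_mul]
    congr 2
    ring
  · rw [← prod_pow_cycCount]
    exact Finset.prod_nonneg fun j _ => pow_nonneg (tsum_nonneg fun z => pow_nonneg (hg0 _) _) _

/-- Theorem 2.2 (a): under the stated assumptions on `ξ` and `ε`, with
logarithmically divergent cycle weights `α_j = γ log j`, `γ > 0`, for any density `ρ > 0`
the fraction of points in infinite cycles is `ν = lim_{K→∞} ν_K = max(0, 1 - ρ_c/ρ)`,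
where `ν_K = liminf_{|Λ|,N→∞} E(N⁻¹ ∑_{i : ℓ⁽ⁱ⁾ > K} ℓ⁽ⁱ⁾)` along the thermodynamic
limit with fixed density `ρ = N/|Λ|`. -/
theorem statement2
    (d : ℕ) (hd : 1 ≤ d) (f ε : Eu d → ℝ) (α : ℕ → ℝ)
    -- assumptions on the jump function `f = e^{-ξ}`
    (hf_cont : Continuous f) (hf_nonneg : ∀ x, 0 ≤ f x)
    (hf_norm : ∫ x : Eu d, f x = 1)
    -- the Fourier transform of `e^{-ξ}` is the positive function `e^{-ε}`
    (hFT : ∀ k : Eu d, 𝓕 (fun x => (f x : ℂ)) k = (Real.exp (-ε k) : ℂ))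
    -- assumptions on the dispersion relation `ε`
    (hε_nonneg : ∀ k, 0 ≤ ε k)
    (hε_uc : UniformContinuous fun k => Real.exp (-ε k))
    (hε_low : ∃ a > (0:ℝ), ∃ η : ℝ, 0 < η ∧ η < d ∧
      ∀ k : Eu d, ‖k‖ ≤ 1 → a * ‖k‖ ^ η ≤ ε k)
    (hε_pos : ∀ δ : ℝ, 0 < δ → ∃ c > (0:ℝ), ∀ k : Eu d, δ ≤ ‖k‖ → c ≤ ε k)
    -- the periodization `e^{-ξ_Λ}` is continuous for all large `L`
    (hper_cont : ∃ L₀ : ℝ, ∀ L ≥ L₀, Continuous (fper d f L))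
    -- convergence of the Riemann sums `|Λ|⁻¹ ∑_{k∈Λ*} e^{-ε(k)} → ∫ e^{-ε(k)} dk`
    (hRiemann : Tendsto
      (fun L : ℝ => (L ^ d)⁻¹ * ∑' z : Fin d → ℤ, Real.exp (-ε (dualPt d L z)))
      atTop (𝓝 (∫ k : Eu d, Real.exp (-ε k))))
    -- logarithmically divergent cycle weights
    (γ : ℝ) (hγ : 0 < γ) (hα : ∀ j : ℕ, 1 ≤ j → α j = γ * Real.log j)
    -- thermodynamic limit at fixed density `ρ > 0`
    (ρ : ℝ) (hρ : 0 < ρ) (Ls : ℕ → ℝ) (Ns : ℕ → ℕ)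
    (hLs : Tendsto Ls atTop atTop)
    (hfix : ∀ m, (Ns m : ℝ) = ρ * Ls m ^ d) :
    Tendsto (fun K : ℕ =>
        Filter.liminf (fun m => gibbsE d f α (Ls m) (Ns m)
          (fun π => (∑ j ∈ Finset.Icc (K+1) (Ns m), (j : ℝ) * cycCount π j) / (Ns m)))
          atTop)
      atTop (𝓝 (max 0 (1 - rhoC d ε α / ρ))) := by
  set g : Eu d → ℝ := fun k => Real.exp (-ε k) with hg
  have hg0 : ∀ k, 0 ≤ g k := fun k => (Real.exp_pos _).le
  have hg1 : ∀ k, g k ≤ 1 := fun k => Real.exp_le_one_iff.2 (by linarith [hε_nonneg k])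
  have hgc : Continuous g := hε_uc.continuous
  have hfi : Integrable f := by
    by_contra h
    rw [integral_undef h] at hf_norm
    exact zero_ne_one hf_norm
  have hFg : ∀ k, 𝓕 (fun x => (f x : ℂ)) k = (g k : ℂ) := hFT
  have hgi : Integrable g :=
    integrable_of_fourier_eq_nonneg hfi.ofReal (by fun_prop) hgc hg0 hg1 hFg
  have hgzero : g 0 = 1 := by
    have h := hFg 0
    rw [Real.fourier_eq'] at h
    simp only [inner_zero_right, mul_zero, Complex.ofReal_zero, zero_mul, Complex.exp_zero,
      one_smul] at h
    rw [integral_complex_ofReal, hf_norm] at h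
    exact_mod_cast h.symm
  have hpow : ∀ j : ℕ, ∀ k, g k ^ j = Real.exp (-((j : ℝ) * ε k)) := by
    intro j k
    rw [hg, ← Real.exp_nat_mul]
    congr 1
    ring
  have hpos : ∀ j : ℕ, 1 ≤ j → Integrable (fun k => g k ^ j) ∧ 0 < ∫ k, g k ^ j := by
    intro j hj
    have hi : Integrable fun k => g k ^ j := by
      refine hgi.mono' (by fun_prop) (Eventually.of_forall fun k => ?_)
      rw [Real.norm_of_nonneg (pow_nonneg (hg0 k) j)]
      exact pow_le_of_le_one (hg0 k) (hg1 k) (by omega)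
    refine ⟨hi, ?_⟩
    exact integral_pos_of_integrable_nonneg_nonzero (x := 0) (by fun_prop) hi
      (fun k => pow_nonneg (hg0 k) j) (by simp [hgzero])
  have hexpα : ∀ j : ℕ, 1 ≤ j → Real.exp (-α j) = (j : ℝ) ^ (-γ) := by
    intro j hj
    rw [hα j hj, Real.rpow_def_of_pos (by exact_mod_cast hj)]
    congr 1
    ring
  have hRm := hRiemann.comp hLs
  have hV : Tendsto (fun m => Ls m ^ d) atTop atTop :=
    (tendsto_pow_atTop (by omega)).comp hLs
  have hIg : 0 < ∫ k, g k := by simpa using (hpos 1 le_rfl).2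
  have hsum : ∀ᶠ m in atTop, Summable fun z => g (dualPt d (Ls m) z) :=
    eventually_summable_of_tendsto_riemann_sum hIg hRm
  have hLpos : ∀ᶠ m in atTop, 0 < Ls m := hLs.eventually_gt_atTop 0
  have hper : ∀ᶠ m in atTop, Continuous (fper d f (Ls m)) := by
    obtain ⟨L₀, hL₀⟩ := hper_cont
    exact (hLs.eventually_ge_atTop L₀).mono fun m hm => hL₀ _ hm
  have hdual0 : ∀ L, dualPt d L 0 = 0 := by
    intro L; ext i; simp [dualPt]
  have hsumpow : ∀ᶠ m in atTop, ∀ j : ℕ, 1 ≤ j →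
      Summable fun z => g (dualPt d (Ls m) z) ^ j := by
    filter_upwards [hsum] with m hm j hj
    exact hm.of_nonneg_of_le (fun z => pow_nonneg (hg0 _) _)
      fun z => pow_le_of_le_one (hg0 _) (hg1 _) (by omega)
  have hone : ∀ᶠ m in atTop, ∀ j : ℕ, 1 ≤ j → 1 ≤ ∑' z, g (dualPt d (Ls m) z) ^ j := by
    filter_upwards [hsumpow] with m hm j hj
    have := (hm j hj).le_tsum 0 fun z _ => pow_nonneg (hg0 _) _
    rwa [hdual0, hgzero, one_pow] at this
  have hθ : ∀ m, ∀ j : ℕ, 1 ≤ j → annealedWeight d g α (Ls m) j =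
      (j : ℝ) ^ (-γ) * ∑' z, g (dualPt d (Ls m) z) ^ j := by
    intro m j hj
    rw [annealedWeight, if_neg (by omega), hexpα j hj]
  have hcs : Summable fun j : ℕ => Real.exp (-α (j + 1)) * ∫ k, g k ^ (j + 1) := by
    have h := summable_integral_exp_neg hd hε_nonneg hgc hgi hε_low hε_pos
    refine h.of_nonneg_of_le (fun j => mul_nonneg (Real.exp_pos _).le
      (hpos (j + 1) (by omega)).2.le) fun j => ?_
    simp_rw [hpow, Nat.cast_succ]
    refine mul_le_of_le_one_left (integral_nonneg fun k => (Real.exp_pos _).le) ?_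
    rw [hα (j + 1) (by omega), Real.exp_le_one_iff]
    have := Real.log_nonneg (x := ((j + 1 : ℕ) : ℝ)) (by push_cast; linarith [j.cast_nonneg (α := ℝ)])
    nlinarith
  have key := tendsto_liminf_long_cycles hγ hρ hV hfix
    (θ := fun m => annealedWeight d g α (Ls m))
    (c := fun j => Real.exp (-α j) * ∫ k, g k ^ j)
    (fun j hj => mul_pos (Real.exp_pos _) (hpos j hj).2) hcs ?_ ?_ ?_ ?_
    (E := fun K m => gibbsE d f α (Ls m) (Ns m)
      (fun π => (∑ j ∈ Finset.Icc (K+1) (Ns m), (j : ℝ) * cycCount π j) / (Ns m))) ?_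
  · have : rhoC d ε α = ∑' j : ℕ, Real.exp (-α (j + 1)) * ∫ k, g k ^ (j + 1) := by
      simp_rw [hpow, Nat.cast_succ]
      rfl
    rw [this]
    exact key
  · intro j hj
    have h := (tendsto_riemann_sum_of_le hLs hgc hgi hsum hRm (h := fun k => g k ^ j)
      (by fun_prop) (fun k => pow_nonneg (hg0 k) j)
      fun k => pow_le_of_le_one (hg0 k) (hg1 k) (by omega)).const_mul (Real.exp (-α j))
    refine h.congr fun m => ?_
    rw [annealedWeight, if_neg (by omega)]
    ring
  · filter_upwards [hone] with m hm j
    rcases Nat.eq_zero_or_pos j with rfl | hj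
    · simp [annealedWeight]
    · rw [annealedWeight, if_neg (by omega)]
      exact mul_pos (Real.exp_pos _) (zero_lt_one.trans_le (hm j hj))
  · filter_upwards [hone] with m hm j hj
    rw [hθ m j hj]
    exact le_mul_of_one_le_right (by positivity) (hm j hj)
  · filter_upwards [hsumpow] with m hm j hj
    rw [hθ m j hj, hθ m 1 le_rfl, Nat.cast_one, Real.one_rpow, one_mul]
    refine mul_le_mul_of_nonneg_left ?_ (by positivity)
    refine (hm j hj).tsum_le_tsum (fun z => ?_) (hm 1 le_rfl)
    rw [pow_one]
    exact pow_le_of_le_one (hg0 _) (hg1 _) (by omega)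
  · intro K
    filter_upwards [hsum, hLpos, hper] with m h1 h2 h3
    simp only [gibbsE, toReal_gibbsW d α hf_cont hf_nonneg hfi hFg hg0 hg1 h2 h1 h3]
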